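/- arXiv:1106.6254 — 2 statements merged into one kernel-verified Lean document; each statement's English description precedes it below -/
import Mathlib

section
/- Let d ≥ 3 be odd and let n1, n2 ≥ d+1. There exist two ⌊d/2⌋-neighborly d-polytopes P1 and P2 in E^d with n1 and n2 vertices, respectively, such that for all k with 1 ≤ k ≤ d: f_{k−1}(P1⊕P2) = f_k(C_{d+1}(n1+n2)) − Σ_{i=0}^{⌊(d+1)/2⌋} binom(d+1−i, k+1−i)·( binom(n1−d−2+i,i) + binom(n2−d−2+i,i) ). In particular, the upper bound on the face numbers of Minkowski sums of two d-polytopes is attained for all odd d ≥ 3. -/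
open Set Pointwise

noncomputable section

/-- Euclidean `d`-space `E^d`, modeled as `Fin d → ℝ`. -/
abbrev Euc (d : ℕ) : Type := Fin d → ℝ

/-- The (affine) dimension of a subset of Euclidean space: the dimension of its affine hull. -/
def setDim {d : ℕ} (F : Set (Euc d)) : ℕ :=
  Module.finrank ℝ (affineSpan ℝ F).direction

/-- A (convex) polytope: the convex hull of a finite point set. -/
def IsPolytope {d : ℕ} (P : Set (Euc d)) : Prop :=
  ∃ S : Set (Euc d), S.Finite ∧ P = convexHull ℝ S

/-- `F` is a proper (nonempty) face of `P`: `F` is an exposed face of `P` (the intersection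
of `P` with a supporting hyperplane) which is nonempty and different from `P` itself. -/
def IsProperFaceOf {d : ℕ} (P F : Set (Euc d)) : Prop :=
  IsExposed ℝ P F ∧ F ≠ P ∧ F.Nonempty

/-- The vertex set of a polytope: its set of extreme points. -/
def vertSet {d : ℕ} (P : Set (Euc d)) : Set (Euc d) :=
  Set.extremePoints ℝ P

/-- The number of vertices of a polytope. -/
def vertCount {d : ℕ} (P : Set (Euc d)) : ℕ := (vertSet P).ncard

/-- `faceCount P k` is `f_k(P)`, the number of `k`-dimensional (proper) faces of `P`. -/
def faceCount {d : ℕ} (P : Set (Euc d)) (k : ℕ) : ℕ :=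
  {F : Set (Euc d) | IsProperFaceOf P F ∧ setDim F = k}.ncard

/-- The moment curve `t ↦ (t, t², …, t^δ)` in `E^δ`. -/
def momentCurve (δ : ℕ) (t : ℝ) : Euc δ := fun i => t ^ ((i : ℕ) + 1)

/-- A standard realization of the cyclic `δ`-polytope `C_δ(n)` with `n` vertices:
the convex hull of `n` distinct points on the moment curve. -/
def cyclicPolytope (δ n : ℕ) : Set (Euc δ) :=
  convexHull ℝ (momentCurve δ '' (Set.range fun j : Fin n => (j : ℝ) + 1))

/-- `S` is the vertex set of a proper face of `P` of dimension `|S| - 1`. -/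
def IsSimplexFaceVertexSet {d : ℕ} (P S : Set (Euc d)) : Prop :=
  ∃ F : Set (Euc d), IsProperFaceOf P F ∧ vertSet F = S ∧ setDim F + 1 = S.ncard

/-- A polytope `P` is `(V1; k)`-bineighborly: `V1` is a nonempty proper subset of the vertex
set of `P`, and for all nonempty `S1 ⊆ V1` and `S2 ⊆ V ∖ V1` with `|S1| + |S2| ≤ k`,
the set `S1 ∪ S2` is the vertex set of a face of `P` of dimension `|S1| + |S2| - 1`. -/
def PolytopeBineighborly {d : ℕ} (P V1 : Set (Euc d)) (k : ℕ) : Prop :=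
  V1.Nonempty ∧ V1 ⊂ vertSet P ∧
    ∀ S1 S2 : Set (Euc d), S1.Nonempty → S2.Nonempty →
      S1 ⊆ V1 → S2 ⊆ vertSet P \ V1 → S1.ncard + S2.ncard ≤ k →
        IsSimplexFaceVertexSet P (S1 ∪ S2)

/-- A polytope is `k`-neighborly if every nonempty subset of at most `k` of its vertices is
the vertex set of a face. -/
def PolytopeNeighborly {d : ℕ} (P : Set (Euc d)) (k : ℕ) : Prop :=
  ∀ S : Set (Euc d), S ⊆ vertSet P → S.Nonempty → S.ncard ≤ k →
    ∃ F : Set (Euc d), IsProperFaceOf P F ∧ vertSet F = S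

/-- Embed `E^d` into the hyperplane `{x_{d+1} = c}` of `E^{d+1}`. -/
def lift {d : ℕ} (c : ℝ) (x : Euc d) : Euc (d + 1) := Fin.snoc x c

/-- The Cayley polytope `CH_{d+1}({P1, P2})` of `P1` embedded in `{x_{d+1} = 0}` and
`P2` embedded in `{x_{d+1} = 1}`. -/
def cayley {d : ℕ} (P1 P2 : Set (Euc d)) : Set (Euc (d + 1)) :=
  convexHull ℝ (lift 0 '' P1 ∪ lift 1 '' P2)

/-- `ubTerm n d k = binom (n - d - 2 + k) k` (equal to the true binomial for `n ≥ d + 1`). -/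
def ubTerm (n d k : ℕ) : ℕ := (n + k - (d + 2)).choose k

/-- The upper bound for `f_{k-1}(P1 ⊕ P2)`:
`f_k(C_{d+1}(n1+n2)) - ∑_{i=0}^{⌊(d+1)/2⌋} binom(d+1-i, k+1-i) (binom(n1-d-2+i, i) + binom(n2-d-2+i, i))`. -/
def minkBound (d n1 n2 k : ℕ) : ℤ :=
  (faceCount (cyclicPolytope (d + 1) (n1 + n2)) k : ℤ)
    - ∑ i ∈ Finset.range ((d + 1) / 2 + 1),
        (if i ≤ k + 1 then ((d + 1 - i).choose (k + 1 - i) : ℤ) else 0)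
          * ((ubTerm n1 d i : ℤ) + (ubTerm n2 d i : ℤ))

/-- A polytopal complex in `E^N`: a finite nonempty collection of polytopes containing `∅`,
closed under taking faces, such that pairwise intersections are faces of both. -/
structure PolyComplex (N : ℕ) where
  faces : Set (Set (Euc N))
  finite_faces : faces.Finite
  empty_mem : ∅ ∈ faces
  polytope_mem : ∀ F ∈ faces, IsPolytope F
  down_closed : ∀ F ∈ faces, ∀ G : Set (Euc N), IsExposed ℝ F G → G ∈ faces
  inter_face : ∀ F ∈ faces, ∀ G ∈ faces, IsExposed ℝ F (F ∩ G) ∧ IsExposed ℝ G (F ∩ G)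

namespace PolyComplex

/-- The vertex set of a complex: its `0`-dimensional faces. -/
def verts {N : ℕ} (C : PolyComplex N) : Set (Euc N) := {v : Euc N | {v} ∈ C.faces}

/-- `C` is a (pure-dimension-bounded) `d`-complex: all faces have dimension at most `d`
and some face has dimension exactly `d`. -/
def IsDComplex {N : ℕ} (C : PolyComplex N) (d : ℕ) : Prop :=
  (∀ F ∈ C.faces, setDim F ≤ d) ∧ ∃ F ∈ C.faces, setDim F = d

/-- A complex `C` is `(V1; k)`-bineighborly. -/
def Bineighborly {N : ℕ} (C : PolyComplex N) (V1 : Set (Euc N)) (k : ℕ) : Prop :=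
  V1.Nonempty ∧ V1 ⊂ C.verts ∧
    ∀ S1 S2 : Set (Euc N), S1.Nonempty → S2.Nonempty →
      S1 ⊆ V1 → S2 ⊆ C.verts \ V1 → S1.ncard + S2.ncard ≤ k →
        ∃ F ∈ C.faces, vertSet F = S1 ∪ S2 ∧ setDim F + 1 = S1.ncard + S2.ncard

/-- A complex is `k`-neighborly if every nonempty subset of at most `k` of its vertices is
the vertex set of a face. -/
def Neighborly {N : ℕ} (C : PolyComplex N) (k : ℕ) : Prop :=
  ∀ S : Set (Euc N), S ⊆ C.verts → S.Nonempty → S.ncard ≤ k →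
    ∃ F ∈ C.faces, vertSet F = S

end PolyComplex

/-- `F` is a simplex: the convex hull of an affinely independent finite point set. -/
def IsSimplexSet {d : ℕ} (F : Set (Euc d)) : Prop :=
  ∃ S : Finset (Euc d),
    AffineIndependent ℝ (fun v : {x // x ∈ S} => (v : Euc d)) ∧
      F = convexHull ℝ (S : Set (Euc d))

/-- A simplicial polytope: all its proper faces are simplices. -/
def IsSimplicialPolytope {d : ℕ} (P : Set (Euc d)) : Prop :=
  IsPolytope P ∧ ∀ F : Set (Euc d), IsProperFaceOf P F → IsSimplexSet F

/-- The collection `𝓕` of proper faces of the Cayley polytope of `P1`, `P2` having at least one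
vertex in (the embedded copy of) each of `P1` and `P2`. -/
def cayleyFaces {d : ℕ} (P1 P2 : Set (Euc d)) : Set (Set (Euc (d + 1))) :=
  {F : Set (Euc (d + 1)) | IsProperFaceOf (cayley P1 P2) F ∧
    (vertSet F ∩ lift 0 '' P1).Nonempty ∧ (vertSet F ∩ lift 1 '' P2).Nonempty}

/-- `fFm1 P1 P2 k = f_{k-1}(𝓕)`, with the convention `f_{-1}(𝓕) = -1`. -/
def fFm1 {d : ℕ} (P1 P2 : Set (Euc d)) : ℕ → ℤ
  | 0 => -1
  | (k + 1) => (({F ∈ cayleyFaces P1 P2 | setDim F = k} : Set (Set (Euc (d + 1)))).ncard : ℤ)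

/-- The `h`-vector of `𝓕`: `h_k(𝓕) = ∑_{i=0}^{k} (-1)^{k-i} binom(d+1-i, d+1-k) f_{i-1}(𝓕)`. -/
def hF {d : ℕ} (P1 P2 : Set (Euc d)) (k : ℕ) : ℤ :=
  ∑ i ∈ Finset.range (k + 1),
    (-1 : ℤ) ^ (k - i) * ((d + 1 - i).choose (d + 1 - k) : ℤ) * fFm1 P1 P2 i

/-- `fBdm1 P k = f_{k-1}(∂P)`, with `f_{-1}(∂P) = 1`. -/
def fBdm1 {d : ℕ} (P : Set (Euc d)) : ℕ → ℤ
  | 0 => 1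
  | (k + 1) => (faceCount P k : ℤ)

/-- The `h`-vector of the boundary complex of a `d`-polytope `P ⊆ E^d`:
`h_k(∂P) = ∑_{i=0}^{k} (-1)^{k-i} binom(d-i, d-k) f_{i-1}(∂P)`. -/
def hBd {d : ℕ} (P : Set (Euc d)) (k : ℕ) : ℤ :=
  ∑ i ∈ Finset.range (k + 1),
    (-1 : ℤ) ^ (k - i) * ((d - i).choose (d - k) : ℤ) * fBdm1 P i

/-- The `g`-vector of `∂P`: `g_0 = h_0 (= 1)` and `g_k = h_k - h_{k-1}`, with the
convention `h_{d+1}(∂P) = 0`. -/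
def gBd {d : ℕ} (P : Set (Euc d)) (k : ℕ) : ℤ :=
  (if k ≤ d then hBd P k else 0)
    - (if k = 0 then 0 else if k - 1 ≤ d then hBd P (k - 1) else 0)

/-- `fCycm1 δ n k = f_{k-1}(C_δ(n))`, with `f_{-1} = 1`. -/
def fCycm1 (δ n k : ℕ) : ℤ :=
  if k = 0 then 1 else (faceCount (cyclicPolytope δ n) (k - 1) : ℤ)

/-- The upper bound for `f_{k-1}(𝓕)`:
`f_{k-1}(C_{d+1}(n1+n2)) - ∑_{i=0}^{⌊(d+1)/2⌋} binom(d+1-i, k-i)(binom(n1-d-2+i,i)+binom(n2-d-2+i,i))`. -/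
def cayleyBound (d n1 n2 k : ℕ) : ℤ :=
  fCycm1 (d + 1) (n1 + n2) k
    - ∑ i ∈ Finset.range ((d + 1) / 2 + 1),
        (if i ≤ k then ((d + 1 - i).choose (k - i) : ℤ) else 0)
          * ((ubTerm n1 d i : ℤ) + (ubTerm n2 d i : ℤ))

/-- The moment-like curve `γ1(t; ζ) = (t, ζ t^d, t², t³, …, t^{d-1}, 0)` in `E^{d+1}`. -/
def gamma1 (d : ℕ) (ζ t : ℝ) : Euc (d + 1) := fun i =>
  if (i : ℕ) = 0 then t
  else if (i : ℕ) = 1 then ζ * t ^ d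
  else if (i : ℕ) = d then 0
  else t ^ (i : ℕ)

/-- The moment-like curve `γ2(s; ζ) = (ζ s^d, s, s², s³, …, s^{d-1}, 1)` in `E^{d+1}`. -/
def gamma2 (d : ℕ) (ζ s : ℝ) : Euc (d + 1) := fun i =>
  if (i : ℕ) = 0 then ζ * s ^ d
  else if (i : ℕ) = 1 then s
  else if (i : ℕ) = d then 1
  else s ^ (i : ℕ)

/-- The `(k+ℓ) × (k+ℓ)` matrix whose determinant is `D_{k,ℓ}(τ)`: rows are
`(1,…,1,0,…,0)`, `(x₁τ,…,x_kτ,0,…,0)`, `(0,…,0,1,…,1)`, `(0,…,0,y₁,…,y_ℓ)` and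
`(x₁^pτ^p,…,x_k^pτ^p,y₁^p,…,y_ℓ^p)` for `p = 2, …, k+ℓ-3`. -/
def Dmat (k l : ℕ) (x : Fin k → ℝ) (y : Fin l → ℝ) (τ : ℝ) :
    Matrix (Fin (k + l)) (Fin (k + l)) ℝ :=
  Matrix.of fun r c =>
    have hcl : (c : ℕ) < k + l := c.isLt
    if hc : (c : ℕ) < k then
      if (r : ℕ) = 0 then 1
      else if (r : ℕ) = 1 then x ⟨(c : ℕ), hc⟩ * τ
      else if (r : ℕ) = 2 then 0
      else if (r : ℕ) = 3 then 0
      else (x ⟨(c : ℕ), hc⟩ * τ) ^ ((r : ℕ) - 2)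
    else
      have hck : (c : ℕ) - k < l := by omega
      if (r : ℕ) = 0 then 0
      else if (r : ℕ) = 1 then 0
      else if (r : ℕ) = 2 then 1
      else if (r : ℕ) = 3 then y ⟨(c : ℕ) - k, hck⟩
      else y ⟨(c : ℕ) - k, hck⟩ ^ ((r : ℕ) - 2)

/-- The exponent vector `μ = (0, 1, k, k+1, …, k+ℓ-3)`. -/
def muExp (k i : ℕ) : ℕ := if i = 0 then 0 else if i = 1 then 1 else k + i - 2

/-- The Vandermonde determinant `VD(x) = ∏_{i<j} (x_j - x_i)`. -/
def VDprod {k : ℕ} (x : Fin k → ℝ) : ℝ :=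
  ∏ p ∈ Finset.univ.filter (fun p : Fin k × Fin k => p.1 < p.2), (x p.2 - x p.1)

/-- The generalized Vandermonde determinant `GVD(y; μ) = det (y_j^{μ_i})` with exponent
vector `μ = (0, 1, k, k+1, …, k+ℓ-3)`. -/
def GVDdet (k : ℕ) {l : ℕ} (y : Fin l → ℝ) : ℝ :=
  (Matrix.of fun i j : Fin l => y j ^ muExp k (i : ℕ)).det

/-- `binom(a, b)` for an integer lower index, zero when `b < 0` or `b > a`. -/
def zchoose (a : ℕ) (b : ℤ) : ℝ := if 0 ≤ b then (a.choose b.toNat : ℝ) else 0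

section Transfer

open Matrix

/-- `S` is exactly the zero set, on the configuration `v`, of a linear functional that is
nonnegative on `v`. -/
def IsFacial {ι : Type*} {m : ℕ} (v : ι → Fin m → ℝ) (S : Finset ι) : Prop :=
  ∃ c : Fin m → ℝ, (∀ i, 0 ≤ v i ⬝ᵥ c) ∧ ∀ i, v i ⬝ᵥ c = 0 ↔ i ∈ S

lemma det_updateRow_mul_dotProduct {m : ℕ} (M : Matrix (Fin m) (Fin m) ℝ) (a : Fin m)
    (c x : Fin m → ℝ) (hc : ∀ r, r ≠ a → M r ⬝ᵥ c = 0) :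
    (M.updateRow a x).det * (M a ⬝ᵥ c) = M.det * (x ⬝ᵥ c) := by
  have h1 : (M.updateRow a x).det = ∑ j, x j * M.adjugate j a := by
    rw [Matrix.det_eq_sum_mul_adjugate_row _ a]
    refine Finset.sum_congr rfl fun j _ => ?_
    rw [Matrix.adjugate_apply, Matrix.adjugate_apply, Matrix.updateRow_idem,
      Matrix.updateRow_self]
  have h2 : M *ᵥ c = Pi.single a (M a ⬝ᵥ c) := by
    ext r
    by_cases hr : r = a
    · subst hr; simp [Matrix.mulVec]
    · simp [hr, Matrix.mulVec, hc r hr]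
  have h3 : M.det • c = M.adjugate *ᵥ (M *ᵥ c) := by
    rw [Matrix.mulVec_mulVec, Matrix.adjugate_mul, Matrix.smul_mulVec, Matrix.one_mulVec]
  rw [h2] at h3
  have h4 : ∀ j, M.det * c j = M.adjugate j a * (M a ⬝ᵥ c) := fun j => by
    have := congrFun h3 j
    simpa [Matrix.mulVec_single] using this
  rw [h1, show x ⬝ᵥ c = ∑ j, x j * c j from rfl, Finset.mul_sum, Finset.sum_mul]
  refine Finset.sum_congr rfl fun j _ => ?_
  linear_combination (-(x j)) * h4 j

variable {ι : Type*} {m : ℕ}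

lemma exists_dotProduct_eq (v : ι → Fin m → ℝ) (f : Fin m → ι)
    (hf : (Matrix.of fun r => v (f r)).det ≠ 0) (g : Fin m → ℝ) :
    ∃ c : Fin m → ℝ, ∀ r, v (f r) ⬝ᵥ c = g r := by
  have hu : IsUnit (Matrix.of fun r => v (f r)) :=
    (Matrix.isUnit_iff_isUnit_det _).2 (isUnit_iff_ne_zero.2 hf)
  obtain ⟨c, hc⟩ := (Matrix.mulVec_surjective_iff_isUnit.2 hu) g
  exact ⟨c, fun r => congrFun hc r⟩

lemma eq_zero_of_dotProduct_eq_zero (v : ι → Fin m → ℝ) (f : Fin m → ι)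
    (hf : (Matrix.of fun r => v (f r)).det ≠ 0) (c : Fin m → ℝ)
    (hc : ∀ r, v (f r) ⬝ᵥ c = 0) : c = 0 := by
  by_contra h
  exact hf (Matrix.exists_mulVec_eq_zero_iff.1 ⟨c, h, funext hc⟩)

lemma exists_injective_range_between [DecidableEq ι] {S U : Finset ι} (hSU : S ⊆ U)
    (hS : S.card ≤ m) (hU : m ≤ U.card) :
    ∃ f : Fin m → ι, Function.Injective f ∧ (∀ s ∈ S, ∃ r, f r = s) ∧ ∀ r, f r ∈ U := by
  obtain ⟨T, hST, hTU, hT⟩ := Finset.exists_subsuperset_card_eq hSU hS hU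
  let e := (T.equivFinOfCardEq hT).symm
  refine ⟨fun r => (e r : ι), Subtype.val_injective.comp e.injective, fun s hs => ?_,
    fun r => hTU (e r).2⟩
  exact ⟨e.symm ⟨s, hST hs⟩, by simp⟩

/-- Moving a nonnegative functional `c` in a direction `b` until it acquires a new zero. -/
lemma exists_add_smul_facial [Fintype ι] (v : ι → Fin m → ℝ) (S : Finset ι) (c b : Fin m → ℝ)
    (hc0 : ∀ i, 0 ≤ v i ⬝ᵥ c) (hcS : ∀ i, v i ⬝ᵥ c = 0 ↔ i ∈ S)
    (hb : ∀ i ∈ S, v i ⬝ᵥ b = 0) (hneg : ∃ i, v i ⬝ᵥ b < 0) :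
    ∃ t : ℝ, 0 < t ∧ (∀ i, 0 ≤ v i ⬝ᵥ (c + t • b)) ∧
      ∃ i, i ∉ S ∧ v i ⬝ᵥ (c + t • b) = 0 := by
  classical
  obtain ⟨i₀, hi₀⟩ := hneg
  obtain ⟨j, hj, hmin⟩ := Finset.exists_min_image (Finset.univ.filter fun i => v i ⬝ᵥ b < 0)
    (fun i => (v i ⬝ᵥ c) / (-(v i ⬝ᵥ b))) ⟨i₀, by simpa using hi₀⟩
  have hjn : v j ⬝ᵥ b < 0 := by simpa using hj
  have hjS : j ∉ S := fun h => hjn.ne (hb j h)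
  have hjc : 0 < v j ⬝ᵥ c := lt_of_le_of_ne (hc0 j) fun h => hjS ((hcS j).1 h.symm)
  refine ⟨(v j ⬝ᵥ c) / (-(v j ⬝ᵥ b)), div_pos hjc (by linarith), fun i => ?_, j, hjS, ?_⟩
  · rw [dotProduct_add, dotProduct_smul, smul_eq_mul]
    by_cases hi : v i ⬝ᵥ b < 0
    · have h := hmin i (by simpa using hi)
      rw [le_div_iff₀ (by linarith)] at h
      linarith
    · have : 0 ≤ (v j ⬝ᵥ c) / (-(v j ⬝ᵥ b)) * (v i ⬝ᵥ b) :=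
        mul_nonneg (div_pos hjc (by linarith)).le (not_lt.1 hi)
      linarith [hc0 i]
  · rw [dotProduct_add, dotProduct_smul, smul_eq_mul]
    have := hjn.ne
    field_simp
    ring

lemma isFacial_inter [DecidableEq ι] {v : ι → Fin m → ℝ} {S T : Finset ι}
    (hS : IsFacial v S) (hT : IsFacial v T) : IsFacial v (S ∩ T) := by
  obtain ⟨c, hc0, hc⟩ := hS
  obtain ⟨b, hb0, hb⟩ := hT
  refine ⟨c + b, fun i => ?_, fun i => ?_⟩
  · rw [dotProduct_add]; exact add_nonneg (hc0 i) (hb0 i)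
  · rw [dotProduct_add, add_eq_zero_iff_of_nonneg (hc0 i) (hb0 i), hc, hb, Finset.mem_inter]

lemma isFacial_univ [Fintype ι] (v : ι → Fin m → ℝ) : IsFacial v Finset.univ :=
  ⟨0, by simp, by simp⟩

/-- A facial set containing a set `S₀` all of whose `m`-element extensions are bases is
either everything or has fewer than `m` elements. -/
lemma IsFacial.card_lt [Fintype ι] [DecidableEq ι] {v : ι → Fin m → ℝ} {S₀ S : Finset ι}
    (hcard : S₀.card ≤ m)
    (hv : ∀ f : Fin m → ι, Function.Injective f → (∀ s ∈ S₀, ∃ r, f r = s) →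
      (Matrix.of fun r => v (f r)).det ≠ 0)
    (hS₀ : S₀ ⊆ S) (hS : IsFacial v S) (hne : S ≠ Finset.univ) : S.card < m := by
  obtain ⟨c, -, hc⟩ := hS
  by_contra! hlt
  obtain ⟨f, hf, hfS, hfU⟩ := exists_injective_range_between hS₀ hcard hlt
  have h0 := eq_zero_of_dotProduct_eq_zero v f (hv f hf hfS) c fun r => (hc _).2 (hfU r)
  exact hne (Finset.eq_univ_of_forall fun i => (hc i).1 (by simp [h0]))

/-- If the determinants of the bases containing `S₀` have the same nonzero signs in two
configurations, then the two configurations have the same facial sets containing `S₀`. -/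
theorem IsFacial.of_sign_det_eq [Fintype ι] [DecidableEq ι] {v w : ι → Fin m → ℝ} {S₀ : Finset ι}
    (hcard : S₀.card < m) (hm : m ≤ Fintype.card ι)
    (hv : ∀ f : Fin m → ι, Function.Injective f → (∀ s ∈ S₀, ∃ r, f r = s) →
      (Matrix.of fun r => v (f r)).det ≠ 0)
    (hvw : ∀ f : Fin m → ι, Function.Injective f → (∀ s ∈ S₀, ∃ r, f r = s) →
      SignType.sign (Matrix.of fun r => v (f r)).det =
        SignType.sign (Matrix.of fun r => w (f r)).det)
    {S : Finset ι} (hS₀ : S₀ ⊆ S) (hS : IsFacial v S) : IsFacial w S := by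
  induction hn : Sᶜ.card using Nat.strong_induction_on generalizing S with
  | _ n ih =>
  by_cases hU : S = Finset.univ
  · rw [hU]; exact isFacial_univ w
  have hlt : S.card < m := hS.card_lt hcard.le hv hS₀ hU
  obtain ⟨c, hc0, hcS⟩ := hS
  have hpos : ∀ i, i ∉ S → 0 < v i ⬝ᵥ c := fun i hi =>
    lt_of_le_of_ne (hc0 i) fun h => hi ((hcS i).1 h.symm)
  by_cases hS1 : S.card + 1 = m
  · obtain ⟨i, hi⟩ : ∃ i, i ∉ S := by
      by_contra! h; exact hU (Finset.eq_univ_of_forall h)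
    obtain ⟨f, hf, hfS, hfU⟩ := exists_injective_range_between (m := m) (U := insert i S)
      (Finset.Subset.refl _) (by rw [Finset.card_insert_of_notMem hi]; omega)
      (by rw [Finset.card_insert_of_notMem hi]; omega)
    have hfS₀ : ∀ s ∈ S₀, ∃ r, f r = s := fun s hs =>
      hfS s (Finset.mem_insert_of_mem (hS₀ hs))
    obtain ⟨a, ha⟩ := hfS i (Finset.mem_insert_self _ _)
    have hra : ∀ r, r ≠ a → f r ∈ S := fun r hr =>
      Finset.mem_of_mem_insert_of_ne (hfU r) fun h => hr (hf (h.trans ha.symm))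
    have hdw : (Matrix.of fun r => w (f r)).det ≠ 0 := by
      rw [← sign_ne_zero, ← hvw f hf hfS₀, sign_ne_zero]; exact hv f hf hfS₀
    obtain ⟨b, hb⟩ := exists_dotProduct_eq w f hdw (Pi.single a 1)
    have hbS : ∀ s ∈ S, w s ⬝ᵥ b = 0 := fun s hs => by
      obtain ⟨r, rfl⟩ := hfS s (Finset.mem_insert_of_mem hs)
      rw [hb r, Pi.single_eq_of_ne]
      rintro rfl
      exact hi (ha ▸ hs)
    have hbpos : ∀ j, j ∉ S → 0 < w j ⬝ᵥ b := fun j hj => by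
      have hup : ∀ u : ι → Fin m → ℝ, (Matrix.of fun r => u (f r)).updateRow a (u j) =
          Matrix.of fun r => u (Function.update f a j r) := fun u => by
        ext r k
        by_cases hr : r = a
        · subst hr; simp
        · simp [hr]
      have hfj : Function.Injective (Function.update f a j) := by
        intro r s hrs
        by_cases hr : r = a <;> by_cases hs : s = a
        · rw [hr, hs]
        · subst hr
          rw [Function.update_self, Function.update_of_ne hs] at hrs
          exact absurd (hra s hs) (hrs ▸ hj)
        · subst hs
          rw [Function.update_self, Function.update_of_ne hr] at hrs
          exact absurd (hra r hr) (hrs ▸ hj)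
        · rw [Function.update_of_ne hr, Function.update_of_ne hs] at hrs
          exact hf hrs
      have hfj₀ : ∀ s ∈ S₀, ∃ r, Function.update f a j r = s := fun s hs => by
        obtain ⟨r, hr⟩ := hfS₀ s hs
        refine ⟨r, ?_⟩
        rw [Function.update_of_ne, hr]
        rintro rfl
        exact hi (by rw [← ha, hr]; exact hS₀ hs)
      have e1 := det_updateRow_mul_dotProduct (Matrix.of fun r => v (f r)) a c (v j)
        fun r hr => (hcS _).2 (hra r hr)
      have e2 := det_updateRow_mul_dotProduct (Matrix.of fun r => w (f r)) a b (w j)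
        fun r hr => hbS _ (hra r hr)
      rw [hup] at e1 e2
      have e1' := congrArg SignType.sign e1
      have e2' := congrArg SignType.sign e2
      rw [sign_mul, sign_mul] at e1' e2'
      have hva : (Matrix.of fun r => v (f r)) a ⬝ᵥ c = v i ⬝ᵥ c := by
        rw [← ha]; rfl
      have hwa : (Matrix.of fun r => w (f r)) a ⬝ᵥ b = 1 := by
        have := hb a
        rw [Pi.single_eq_same] at this
        exact this
      rw [hva, sign_pos (hpos i hi), sign_pos (hpos j hj), mul_one, mul_one,
        hvw _ hfj hfj₀, hvw _ hf hfS₀] at e1'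
      rw [hwa, sign_one, mul_one, e1'] at e2'
      have h0 : SignType.sign (Matrix.of fun r => w (f r)).det ≠ 0 := sign_ne_zero.2 hdw
      rw [← sign_eq_one_iff]
      generalize SignType.sign (w j ⬝ᵥ b) = x at e2'
      generalize SignType.sign (Matrix.of fun r => w (f r)).det = y at e2' h0
      revert x y; decide
    refine ⟨b, fun j => ?_, fun j => ⟨fun h => ?_, hbS j⟩⟩
    · by_cases hj : j ∈ S
      · exact (hbS j hj).ge
      · exact (hbpos j hj).le
    · by_contra hj
      exact (hbpos j hj).ne' h
  · have h2 : 2 ≤ Sᶜ.card := by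
      rw [Finset.card_compl]; omega
    obtain ⟨i, hi, j, hj, hij⟩ := Finset.one_lt_card.1 h2
    rw [Finset.mem_compl] at hi hj
    have hiS : i ∉ insert j S := by simp [hi, hij]
    obtain ⟨f, hf, hfS, -⟩ := exists_injective_range_between (m := m)
      (Finset.subset_univ (insert i (insert j S)))
      (by rw [Finset.card_insert_of_notMem hiS, Finset.card_insert_of_notMem hj]; omega)
      (by simpa using hm)
    have hfS₀ : ∀ s ∈ S₀, ∃ r, f r = s := fun s hs =>
      hfS s (by simp [hS₀ hs])
    obtain ⟨a, ha⟩ := hfS i (by simp)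
    obtain ⟨a', ha'⟩ := hfS j (by simp)
    have haa : a ≠ a' := by rintro rfl; exact hij (ha.symm.trans ha')
    obtain ⟨b, hb⟩ := exists_dotProduct_eq v f (hv f hf hfS₀) (Pi.single a 1 - Pi.single a' 1)
    have hbi : v i ⬝ᵥ b = 1 := by rw [← ha, hb]; simp [haa]
    have hbj : v j ⬝ᵥ b = -1 := by rw [← ha', hb]; simp [haa.symm]
    have hbS : ∀ s ∈ S, v s ⬝ᵥ b = 0 := fun s hs => by
      obtain ⟨r, hr⟩ := hfS s (by simp [hs])
      have h1 : r ≠ a := by rintro rfl; exact hi (by rw [← ha, hr]; exact hs)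
      have h2 : r ≠ a' := by rintro rfl; exact hj (by rw [← ha', hr]; exact hs)
      rw [← hr, hb]; simp [h1, h2]
    obtain ⟨t, ht, htn, k, hk, htk⟩ := exists_add_smul_facial v S c b hc0 hcS hbS
      ⟨j, by rw [hbj]; norm_num⟩
    obtain ⟨t', ht', htn', k', hk', htk'⟩ := exists_add_smul_facial v S c (-b) hc0 hcS
      (fun s hs => by rw [dotProduct_neg, hbS s hs, neg_zero])
      ⟨i, by rw [dotProduct_neg, hbi]; norm_num⟩
    have key : ∀ (u : Fin m → ℝ), (∀ s ∈ S, v s ⬝ᵥ u = 0) → (∀ s, 0 ≤ v s ⬝ᵥ u) →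
        (∃ k, k ∉ S ∧ v k ⬝ᵥ u = 0) →
        IsFacial w (Finset.univ.filter fun s => v s ⬝ᵥ u = 0) := by
      rintro u huS hu0 ⟨k, hk, hku⟩
      have hsub : S ⊆ Finset.univ.filter fun s => v s ⬝ᵥ u = 0 := fun s hs => by
        simpa using huS s hs
      refine ih _ ?_ (hS₀.trans hsub) ⟨u, hu0, by simp⟩ rfl
      rw [← hn]
      refine Finset.card_lt_card ((Finset.ssubset_iff_of_subset
        (Finset.compl_subset_compl.2 hsub)).2 ⟨k, by simpa using hk, by simpa using hku⟩)
    have hA := key (c + t • b) (fun s hs => by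
      rw [dotProduct_add, dotProduct_smul, hbS s hs, (hcS s).2 hs]; simp) htn ⟨k, hk, htk⟩
    have hB := key (c + t' • (-b)) (fun s hs => by
      rw [dotProduct_add, dotProduct_smul, dotProduct_neg, hbS s hs, (hcS s).2 hs]; simp) htn'
      ⟨k', hk', htk'⟩
    convert isFacial_inter hA hB using 1
    ext s
    simp only [Finset.mem_inter, Finset.mem_filter, Finset.mem_univ, true_and, dotProduct_add,
      dotProduct_smul, dotProduct_neg, smul_eq_mul]
    refine ⟨fun hs => by rw [(hcS s).2 hs, hbS s hs]; simp, fun ⟨h1, h2⟩ => (hcS s).1 ?_⟩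
    have h3 : (t + t') * (v s ⬝ᵥ c) = 0 := by linear_combination t' * h1 + t * h2
    exact (mul_eq_zero.1 h3).resolve_left (by positivity)

end Transfer

section Faces

open Matrix

lemma convexHull_image_eq_of_le {ι : Type*} {D : ℕ} (p : ι → Euc D) (S : Set ι)
    (hne : S.Nonempty) (g : Euc D →ₗ[ℝ] ℝ) (a : ℝ) (hle : ∀ i, g (p i) ≤ a)
    (heq : ∀ i, g (p i) = a ↔ i ∈ S) :
    convexHull ℝ (p '' S) =
      {x ∈ convexHull ℝ (Set.range p) | ∀ y ∈ convexHull ℝ (Set.range p), g y ≤ g x} ∧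
    ∀ x ∈ convexHull ℝ (p '' S), g x = a := by
  have hmax : ∀ y ∈ convexHull ℝ (Set.range p), g y ≤ a := fun y hy =>
    convexHull_min (t := {z | g z ≤ a}) (by rintro _ ⟨i, rfl⟩; exact hle i)
      (convex_halfSpace_le g.isLinear a) hy
  have hSa : ∀ y ∈ convexHull ℝ (p '' S), g y = a := fun y hy =>
    convexHull_min (t := {z | g z = a}) (by rintro _ ⟨i, hi, rfl⟩; exact (heq i).2 hi)
      (convex_hyperplane g.isLinear a) hy
  obtain ⟨i₀, hi₀⟩ := hne
  refine ⟨Set.Subset.antisymm (fun x hx => ⟨convexHull_mono (Set.image_subset_range _ _) hx,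
    fun y hy => by rw [hSa x hx]; exact hmax y hy⟩) ?_, hSa⟩
  rintro x ⟨hx, hxm⟩
  have hxa : g x = a := le_antisymm (hmax x hx) (by
    rw [← (heq i₀).2 hi₀]; exact hxm _ (subset_convexHull ℝ _ ⟨i₀, rfl⟩))
  obtain ⟨κ, _, w, z, hw0, hw1, hz, rfl⟩ := mem_convexHull_iff_exists_fintype.1 hx
  have hzle : ∀ k, g (z k) ≤ a := fun k => by obtain ⟨i, hi⟩ := hz k; rw [← hi]; exact hle i
  have hsum : ∑ k, w k * (a - g (z k)) = 0 := by
    simp only [mul_sub, Finset.sum_sub_distrib, ← Finset.sum_mul, hw1, one_mul]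
    rw [← hxa]; simp
  have hz0 := (Finset.sum_eq_zero_iff_of_nonneg fun k _ =>
    mul_nonneg (hw0 k) (sub_nonneg.2 (hzle k))).1 hsum
  classical
  refine mem_convexHull_of_exists_fintype w (fun k => if w k = 0 then p i₀ else z k) hw0 hw1
    (fun k => ?_) (Finset.sum_congr rfl fun k _ => ?_)
  · by_cases hk : w k = 0
    · simp only [hk, if_true]; exact ⟨i₀, hi₀, rfl⟩
    · simp only [hk, if_false]
      obtain ⟨i, hi⟩ := hz k
      have := (mul_eq_zero.1 (hz0 k (Finset.mem_univ _))).resolve_left hk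
      exact ⟨i, (heq i).1 (by rw [hi]; linarith), hi⟩
  · by_cases hk : w k = 0 <;> simp [hk]

/-- The homogenization of a point configuration. -/
def homog {ι : Type*} {D : ℕ} (p : ι → Euc D) (i : ι) : Fin (D + 1) → ℝ :=
  Fin.cons 1 (p i)

lemma homog_dotProduct {ι : Type*} {D : ℕ} (p : ι → Euc D) (i : ι) (c : Fin (D + 1) → ℝ) :
    homog p i ⬝ᵥ c = c 0 + ∑ r, p i r * c r.succ := by
  simp [homog, dotProduct, Fin.sum_univ_succ]

lemma IsFacial.convexHull_image {ι : Type*} {D : ℕ} {p : ι → Euc D} {S : Finset ι}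
    (hS : IsFacial (homog p) S) (hne : S.Nonempty) :
    IsExposed ℝ (convexHull ℝ (Set.range p)) (convexHull ℝ (p '' S)) ∧
      ∀ i, p i ∈ convexHull ℝ (p '' S) ↔ i ∈ S := by
  obtain ⟨c, hc0, hc⟩ := hS
  let g : Euc D →ₗ[ℝ] ℝ := -∑ r : Fin D, (c r.succ) • LinearMap.proj r
  have hg : ∀ x, g x = -∑ r, x r * c r.succ := fun x => by
    simp [g, mul_comm]
  have hgc : ∀ i, homog p i ⬝ᵥ c = c 0 - g (p i) := fun i => by
    rw [homog_dotProduct, hg]; ring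
  obtain ⟨h1, h2⟩ := convexHull_image_eq_of_le p S hne g (c 0)
    (fun i => by have := hc0 i; rw [hgc] at this; linarith)
    (fun i => by
      rw [Finset.mem_coe, ← hc i, hgc]
      exact ⟨fun h => by linarith, fun h => by linarith⟩)
  refine ⟨fun _ => ⟨g.toContinuousLinearMap, h1⟩, fun i => ⟨fun hi => ?_, fun hi =>
    subset_convexHull ℝ _ ⟨i, hi, rfl⟩⟩⟩
  rw [← hc i, hgc, h2 _ hi, sub_self]

lemma exists_isFacial_of_isExposed {ι : Type*} [Fintype ι] {D : ℕ} (p : ι → Euc D)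
    {F : Set (Euc D)} (hF : IsExposed ℝ (convexHull ℝ (Set.range p)) F) (hne : F.Nonempty) :
    ∃ S : Finset ι, S.Nonempty ∧ IsFacial (homog p) S ∧ F = convexHull ℝ (p '' S) := by
  classical
  obtain ⟨l, rfl⟩ := hF hne
  obtain ⟨x, hx, -⟩ := hne
  have hι : Nonempty ι := by
    by_contra h
    rw [not_nonempty_iff] at h
    rw [Set.range_eq_empty, convexHull_empty] at hx
    exact hx
  obtain ⟨i₀, -, hi₀⟩ := Finset.exists_max_image Finset.univ (fun i => l (p i))
    Finset.univ_nonempty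
  refine ⟨Finset.univ.filter fun i => l (p i) = l (p i₀), ⟨i₀, by simp⟩, ?_, ?_⟩
  · have hl : ∀ i, homog p i ⬝ᵥ (Fin.cons (l (p i₀)) fun r => -l (Pi.single r 1)) =
        l (p i₀) - l (p i) := fun i => by
      have h := LinearMap.pi_apply_eq_sum_univ l.toLinearMap (p i)
      have hs : ∀ r : Fin D, (fun j => if r = j then (1 : ℝ) else 0) = Pi.single r 1 :=
        fun r => by ext j; simp [Pi.single_apply, eq_comm]
      simp only [hs, ContinuousLinearMap.coe_coe, smul_eq_mul] at h
      rw [homog_dotProduct, h]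
      simp [sub_eq_add_neg]
    refine ⟨Fin.cons (l (p i₀)) fun r => -l (Pi.single r 1), fun i => ?_, fun i => ?_⟩
    · rw [hl]; linarith [hi₀ i (Finset.mem_univ _)]
    · rw [hl, sub_eq_zero]; simp [eq_comm]
  · exact ((convexHull_image_eq_of_le p _ ⟨i₀, by simp⟩ l.toLinearMap (l (p i₀))
      (fun i => hi₀ i (Finset.mem_univ _)) (fun i => by simp)).1).symm

lemma setDim_convexHull {D : ℕ} (A : Set (Euc D)) :
    setDim (convexHull ℝ A) = Module.finrank ℝ (vectorSpan ℝ A) := by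
  rw [setDim, affineSpan_convexHull, direction_affineSpan]

/-- The faces of a polytope correspond to the facial sets of a generating configuration. -/
lemma faceCount_convexHull_range {ι : Type*} [Fintype ι] {D : ℕ} (p : ι → Euc D) (k : ℕ) :
    faceCount (convexHull ℝ (Set.range p)) k =
      {S : Finset ι | S.Nonempty ∧ S ≠ Finset.univ ∧ IsFacial (homog p) S ∧
        setDim (convexHull ℝ (p '' S)) = k}.ncard := by
  symm
  refine Set.ncard_congr (fun S _ => convexHull ℝ (p '' S)) ?_ ?_ ?_
  · rintro S ⟨hne, hU, hS, hk⟩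
    obtain ⟨h1, h2⟩ := hS.convexHull_image hne
    refine ⟨⟨h1, fun h => hU ?_, ?_⟩, hk⟩
    · exact Finset.eq_univ_of_forall fun i => (h2 i).1
        (h ▸ subset_convexHull ℝ _ ⟨i, rfl⟩)
    · exact (Set.Nonempty.image _ hne).convexHull
  · rintro S T ⟨hSne, -, hS, -⟩ ⟨hTne, -, hT, -⟩ hST
    ext i
    rw [← (hS.convexHull_image hSne).2 i, ← (hT.convexHull_image hTne).2 i]
    exact iff_of_eq (congrArg (p i ∈ ·) hST)
  · rintro F ⟨⟨hF, hFP, hne⟩, hk⟩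
    obtain ⟨S, hSne, hS, rfl⟩ := exists_isFacial_of_isExposed p hF hne
    refine ⟨S, ⟨hSne, ?_, hS, hk⟩, rfl⟩
    rintro rfl
    exact hFP (by simp)

lemma affineIndependent_of_linearIndependent {ι V W : Type*} [AddCommGroup V] [Module ℝ V]
    [AddCommGroup W] [Module ℝ W] (p : ι → V) (T : ℝ × V →ₗ[ℝ] W)
    (h : LinearIndependent ℝ fun i => T (1, p i)) : AffineIndependent ℝ p := by
  rw [affineIndependent_iff]
  intro s w hw hp
  refine linearIndependent_iff'.1 h s w ?_
  have : ∑ i ∈ s, w i • T (1, p i) = T (∑ i ∈ s, w i, ∑ i ∈ s, w i • p i) := by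
    have h2 : (∑ i ∈ s, w i, ∑ i ∈ s, w i • p i) = ∑ i ∈ s, w i • ((1 : ℝ), p i) := by
      ext <;> simp [Prod.fst_sum, Prod.snd_sum]
    rw [h2, map_sum]
    simp only [map_smul]
  rw [this, hw, hp]
  exact map_zero T

lemma linearIndependent_subtype_of_det_ne_zero {ι : Type*} {m : ℕ} (v : ι → Fin m → ℝ)
    (S : Finset ι) (f : Fin m → ι) (hf : (Matrix.of fun r => v (f r)).det ≠ 0)
    (hS : ∀ s ∈ S, ∃ r, f r = s) : LinearIndependent ℝ fun s : S => v s := by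
  have h := Matrix.linearIndependent_rows_of_det_ne_zero hf
  choose g hg using fun s : S => hS s s.2
  have hgi : Function.Injective g := fun s t hst => Subtype.ext (by rw [← hg s, ← hg t, hst])
  have h2 : (fun s : S => v s) = (Matrix.of fun r => v (f r)).row ∘ g := by
    funext s
    rw [← hg s]
    rfl
  rw [h2]
  exact h.comp g hgi

lemma finrank_vectorSpan_image {ι : Type*} {D : ℕ} (p : ι → Euc D) (S : Finset ι)
    (hne : S.Nonempty) (h : AffineIndependent ℝ fun s : S => p s) :
    Module.finrank ℝ (vectorSpan ℝ (p '' S)) + 1 = S.card := by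
  have hc : Fintype.card S = S.card - 1 + 1 := by
    have := hne.card_pos
    rw [Fintype.card_coe]; omega
  have := h.finrank_vectorSpan hc
  rw [Set.image_eq_range]
  have h2 := hne.card_pos
  change Module.finrank ℝ (vectorSpan ℝ (Set.range fun s : S => p s)) + 1 = _
  omega

/-- The embedding `(a, x) ↦ (a, x)` of `ℝ × E^D` into `ℝ^(D+1)`. -/
def consMap (D : ℕ) : ℝ × Euc D →ₗ[ℝ] (Fin (D + 1) → ℝ) where
  toFun x := Fin.cons x.1 x.2
  map_add' x y := by ext r; refine Fin.cases ?_ (fun r => ?_) r <;> simp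
  map_smul' c x := by ext r; refine Fin.cases ?_ (fun r => ?_) r <;> simp

lemma setDim_convexHull_image_of_det {ι : Type*} {D : ℕ} (p : ι → Euc D) (S : Finset ι)
    (hne : S.Nonempty) (f : Fin (D + 1) → ι)
    (hf : (Matrix.of fun r => homog p (f r)).det ≠ 0) (hS : ∀ s ∈ S, ∃ r, f r = s) :
    setDim (convexHull ℝ (p '' S)) + 1 = S.card := by
  rw [setDim_convexHull]
  refine finrank_vectorSpan_image p S hne
    (affineIndependent_of_linearIndependent (fun s : S => p s) (consMap D) ?_)
  exact linearIndependent_subtype_of_det_ne_zero (homog p) S f hf hS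

/-- Face numbers of a simplicial polytope spanned by points in general position. -/
lemma faceCount_convexHull_range_of_det {ι : Type*} [Fintype ι] {D : ℕ} (p : ι → Euc D)
    (hcard : D + 1 ≤ Fintype.card ι)
    (hp : ∀ f : Fin (D + 1) → ι, Function.Injective f →
      (Matrix.of fun r => homog p (f r)).det ≠ 0) {k : ℕ} (hk : k < D) :
    faceCount (convexHull ℝ (Set.range p)) k =
      {S : Finset ι | IsFacial (homog p) S ∧ S.card = k + 1}.ncard := by
  classical
  have hdim : ∀ S : Finset ι, S.Nonempty → S.card ≤ D + 1 →
      setDim (convexHull ℝ (p '' S)) + 1 = S.card := fun S hne hc => by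
    obtain ⟨f, hf, hfS, -⟩ := exists_injective_range_between (m := D + 1)
      (Finset.subset_univ S) hc (by simpa using hcard)
    exact setDim_convexHull_image_of_det p S hne f (hp f hf) hfS
  rw [faceCount_convexHull_range]
  congr 1
  ext S
  constructor
  · rintro ⟨hne, hU, hS, hk'⟩
    have hc : S.card < D + 1 := hS.card_lt (S₀ := ∅) (by simp) (fun f hf _ => hp f hf)
      (by simp) hU
    exact ⟨hS, by rw [← hdim S hne hc.le, hk']⟩
  · rintro ⟨hS, hc⟩
    have hne : S.Nonempty := Finset.card_pos.1 (by omega)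
    refine ⟨hne, ?_, hS, ?_⟩
    · rintro rfl
      rw [Finset.card_univ] at hc
      omega
    · have := hdim S hne (by omega)
      omega

end Faces

section MinkowskiSum

open Matrix

/-- The map `(a, x, b) ↦ (a, x, b)` from `ℝ × E^d × ℝ` to `ℝ^(d+2)`. -/
def cayMap (d : ℕ) : ℝ × Euc d × ℝ →ₗ[ℝ] (Fin (d + 2) → ℝ) where
  toFun x := Fin.cons x.1 (Fin.snoc x.2.1 x.2.2 : Fin (d + 1) → ℝ)
  map_add' x y := by
    ext r
    refine Fin.cases ?_ (fun r => ?_) r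
    · simp
    · refine Fin.lastCases ?_ (fun r => ?_) r <;> simp
  map_smul' c x := by
    ext r
    refine Fin.cases ?_ (fun r => ?_) r
    · simp
    · refine Fin.lastCases ?_ (fun r => ?_) r <;> simp

lemma cayMap_dotProduct {d : ℕ} (a b : ℝ) (x : Euc d) (c : Fin (d + 2) → ℝ) :
    cayMap d (a, x, b) ⬝ᵥ c =
      a * c 0 + ∑ r : Fin d, x r * c r.castSucc.succ + b * c (Fin.last _) := by
  simp only [cayMap, LinearMap.coe_mk, AddHom.coe_mk, dotProduct]
  rw [Fin.sum_univ_succ, Fin.sum_univ_castSucc]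
  simp [add_assoc]

lemma cayMap_zero_injective {d : ℕ} {x : Euc d} (h : cayMap d (0, x, 0) = 0) : x = 0 := by
  ext r
  have := congrFun h r.castSucc.succ
  simpa [cayMap] using this

/-- The homogenized Cayley configuration of two point configurations. -/
def cayConf {ι κ : Type*} {d : ℕ} (p : ι → Euc d) (q : κ → Euc d) :
    ι ⊕ κ → Fin (d + 2) → ℝ :=
  Sum.elim (fun i => cayMap d (1, p i, 0)) (fun j => cayMap d (0, q j, 1))

/-- The configuration of pairwise sums. -/
def sumConf {ι κ : Type*} {d : ℕ} (p : ι → Euc d) (q : κ → Euc d) (x : ι × κ) : Euc d :=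
  p x.1 + q x.2

variable {ι κ : Type*} {d : ℕ} (p : ι → Euc d) (q : κ → Euc d)

lemma convexHull_range_add :
    convexHull ℝ (Set.range p) + convexHull ℝ (Set.range q) =
      convexHull ℝ (Set.range (sumConf p q)) := by
  rw [← convexHull_add]
  congr 1
  ext x
  simp [Set.mem_add, sumConf]

lemma isFacial_product {S₁ : Finset ι} {S₂ : Finset κ}
    (h : IsFacial (cayConf p q) (S₁.disjSum S₂)) :
    IsFacial (homog (sumConf p q)) (S₁ ×ˢ S₂) := by
  obtain ⟨c, hc0, hc⟩ := h
  have hsum : ∀ i j, homog (sumConf p q) (i, j) ⬝ᵥ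
      (Fin.cons (c 0 + c (Fin.last _)) fun r : Fin d => c r.castSucc.succ) =
      cayConf p q (Sum.inl i) ⬝ᵥ c + cayConf p q (Sum.inr j) ⬝ᵥ c := fun i j => by
    simp only [homog_dotProduct, cayConf, Sum.elim_inl, Sum.elim_inr, cayMap_dotProduct,
      Fin.cons_zero, Fin.cons_succ, sumConf, Pi.add_apply, add_mul, Finset.sum_add_distrib]
    ring
  refine ⟨Fin.cons (c 0 + c (Fin.last _)) fun r : Fin d => c r.castSucc.succ,
    fun x => ?_, fun x => ?_⟩
  · rw [hsum x.1 x.2]; exact add_nonneg (hc0 _) (hc0 _)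
  · rw [hsum x.1 x.2, add_eq_zero_iff_of_nonneg (hc0 _) (hc0 _), hc, hc]
    simp

lemma exists_isFacial_of_product [DecidableEq ι] [DecidableEq κ] {S : Finset (ι × κ)}
    (hne : S.Nonempty) (h : IsFacial (homog (sumConf p q)) S) :
    ∃ (S₁ : Finset ι) (S₂ : Finset κ), S₁.Nonempty ∧ S₂.Nonempty ∧ S = S₁ ×ˢ S₂ ∧
      IsFacial (cayConf p q) (S₁.disjSum S₂) := by
  obtain ⟨c, hc0, hc⟩ := h
  obtain ⟨⟨i₀, j₀⟩, h₀⟩ := hne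
  have hval : ∀ i j, homog (sumConf p q) (i, j) ⬝ᵥ c =
      c 0 + ∑ r, p i r * c r.succ + ∑ r, q j r * c r.succ := fun i j => by
    simp only [homog_dotProduct, sumConf, Pi.add_apply, add_mul, Finset.sum_add_distrib]
    ring
  set P : ι → ℝ := fun i => ∑ r, p i r * c r.succ with hP
  set Q : κ → ℝ := fun j => ∑ r, q j r * c r.succ with hQ
  have hv0 : c 0 + P i₀ + Q j₀ = 0 := by rw [← hval]; exact (hc _).2 h₀
  have hPi : ∀ i, P i₀ ≤ P i := fun i => by
    have := hc0 (i, j₀); rw [hval] at this; linarith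
  have hQj : ∀ j, Q j₀ ≤ Q j := fun j => by
    have := hc0 (i₀, j); rw [hval] at this; linarith
  have hmem : ∀ i j, (i, j) ∈ S ↔ P i = P i₀ ∧ Q j = Q j₀ := fun i j => by
    rw [← hc, hval]
    constructor
    · intro h
      have h1 := hPi i
      have h2 := hQj j
      constructor <;> linarith
    · rintro ⟨h1, h2⟩; linarith
  have hfst : ∀ i, i ∈ S.image Prod.fst ↔ P i = P i₀ := fun i => by
    rw [Finset.mem_image]
    constructor
    · rintro ⟨⟨i', j'⟩, h, rfl⟩; exact ((hmem _ _).1 h).1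
    · exact fun h => ⟨(i, j₀), (hmem _ _).2 ⟨h, rfl⟩, rfl⟩
  have hsnd : ∀ j, j ∈ S.image Prod.snd ↔ Q j = Q j₀ := fun j => by
    rw [Finset.mem_image]
    constructor
    · rintro ⟨⟨i', j'⟩, h, rfl⟩; exact ((hmem _ _).1 h).2
    · exact fun h => ⟨(i₀, j), (hmem _ _).2 ⟨rfl, h⟩, rfl⟩
  refine ⟨S.image Prod.fst, S.image Prod.snd, ⟨i₀, (hfst _).2 rfl⟩, ⟨j₀, (hsnd _).2 rfl⟩, ?_,
    cayMap d (-P i₀, fun r => c r.succ, -Q j₀), ?_⟩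
  · ext ⟨i, j⟩
    rw [Finset.mem_product, hfst, hsnd, hmem]
  have hl : ∀ i, cayConf p q (Sum.inl i) ⬝ᵥ cayMap d (-P i₀, fun r => c r.succ, -Q j₀) =
      P i - P i₀ := fun i => by
    rw [cayConf, Sum.elim_inl, cayMap_dotProduct]
    simp [cayMap, hP]
    ring
  have hr : ∀ j, cayConf p q (Sum.inr j) ⬝ᵥ cayMap d (-P i₀, fun r => c r.succ, -Q j₀) =
      Q j - Q j₀ := fun j => by
    rw [cayConf, Sum.elim_inr, cayMap_dotProduct]
    simp [cayMap, hQ, ← Fin.succ_last]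
    ring
  constructor
  · rintro (i | j)
    · rw [hl]; linarith [hPi i]
    · rw [hr]; linarith [hQj j]
  · rintro (i | j)
    · rw [hl, sub_eq_zero, Finset.inl_mem_disjSum, hfst]
    · rw [hr, sub_eq_zero, Finset.inr_mem_disjSum, hsnd]

lemma vectorSpan_add_set {A B : Set (Euc d)} (hA : A.Nonempty) (hB : B.Nonempty) :
    vectorSpan ℝ (A + B) = vectorSpan ℝ A ⊔ vectorSpan ℝ B := by
  apply le_antisymm
  · rw [vectorSpan_def, Submodule.span_le]
    rintro _ ⟨_, ⟨a, ha, b, hb, rfl⟩, _, ⟨a', ha', b', hb', rfl⟩, rfl⟩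
    have : (a + b) -ᵥ (a' + b') = (a -ᵥ a') + (b -ᵥ b') := by
      simp only [vsub_eq_sub]; abel
    simp only [this]
    exact Submodule.add_mem_sup (vsub_mem_vectorSpan ℝ ha ha') (vsub_mem_vectorSpan ℝ hb hb')
  · obtain ⟨a₀, ha₀⟩ := hA
    obtain ⟨b₀, hb₀⟩ := hB
    refine sup_le ?_ ?_ <;> rw [vectorSpan_def, Submodule.span_le]
    · rintro _ ⟨a, ha, a', ha', rfl⟩
      have := vsub_mem_vectorSpan ℝ (Set.add_mem_add ha hb₀) (Set.add_mem_add ha' hb₀)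
      simpa using this
    · rintro _ ⟨b, hb, b', hb', rfl⟩
      have := vsub_mem_vectorSpan ℝ (Set.add_mem_add ha₀ hb) (Set.add_mem_add ha₀ hb')
      simpa using this

lemma cayMap_mem_span_of_mem_vectorSpan {α : Type*} (u : α → Euc d) (A : Set α) (a b : ℝ)
    {x : Euc d} (hx : x ∈ vectorSpan ℝ (u '' A)) :
    cayMap d (0, x, 0) ∈ Submodule.span ℝ ((fun i => cayMap d (a, u i, b)) '' A) := by
  let E : Euc d →ₗ[ℝ] (Fin (d + 2) → ℝ) :=
    cayMap d ∘ₗ LinearMap.inr ℝ ℝ (Euc d × ℝ) ∘ₗ LinearMap.inl ℝ (Euc d) ℝ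
  have hle : vectorSpan ℝ (u '' A) ≤
      (Submodule.span ℝ ((fun i => cayMap d (a, u i, b)) '' A)).comap E := by
    rw [vectorSpan_def, Submodule.span_le]
    rintro _ ⟨_, ⟨i, hi, rfl⟩, _, ⟨j, hj, rfl⟩, rfl⟩
    have : E (u i -ᵥ u j) = cayMap d (a, u i, b) - cayMap d (a, u j, b) := by
      rw [← map_sub]
      simp [E]
    simp only [SetLike.mem_coe, Submodule.mem_comap]
    rw [this]
    exact sub_mem (Submodule.subset_span ⟨i, hi, rfl⟩) (Submodule.subset_span ⟨j, hj, rfl⟩)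
  exact hle hx

lemma setDim_convexHull_sumConf {S₁ : Finset ι} {S₂ : Finset κ} (h₁ : S₁.Nonempty)
    (h₂ : S₂.Nonempty)
    (hli : LinearIndependent ℝ fun s : (S₁.disjSum S₂ : Finset (ι ⊕ κ)) => cayConf p q s) :
    setDim (convexHull ℝ (sumConf p q '' ((S₁ ×ˢ S₂ : Finset (ι × κ)) : Set (ι × κ)))) + 2 =
      (S₁.disjSum S₂).card := by
  have himg : sumConf p q '' ((S₁ ×ˢ S₂ : Finset (ι × κ)) : Set (ι × κ)) =
      p '' (S₁ : Set ι) + q '' (S₂ : Set κ) := by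
    ext x
    simp only [Finset.coe_product, Set.mem_image, Set.mem_prod, Prod.exists, Set.mem_add, sumConf]
    aesop
  have hA := finrank_vectorSpan_image p S₁ h₁ (affineIndependent_of_linearIndependent _
    (cayMap d ∘ₗ (LinearMap.id.prodMap (LinearMap.inl ℝ (Euc d) ℝ)))
    (hli.comp (fun s : S₁ => ⟨Sum.inl s, Finset.inl_mem_disjSum.2 s.2⟩)
      fun s t h => Subtype.ext (Sum.inl_injective (congrArg Subtype.val h))))
  have hB := finrank_vectorSpan_image q S₂ h₂ (affineIndependent_of_linearIndependent _
    (cayMap d ∘ₗ LinearMap.inr ℝ ℝ (Euc d × ℝ) ∘ₗ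
      (LinearMap.snd ℝ ℝ (Euc d)).prod (LinearMap.fst ℝ ℝ (Euc d)))
    (hli.comp (fun s : S₂ => ⟨Sum.inr s, Finset.inr_mem_disjSum.2 s.2⟩)
      fun s t h => Subtype.ext (Sum.inr_injective (congrArg Subtype.val h))))
  have hinf : vectorSpan ℝ (p '' (S₁ : Set ι)) ⊓ vectorSpan ℝ (q '' (S₂ : Set κ)) = ⊥ := by
    rw [eq_bot_iff]
    rintro x ⟨hx₁, hx₂⟩
    have e₁ := cayMap_mem_span_of_mem_vectorSpan p _ 1 0 hx₁
    have e₂ := cayMap_mem_span_of_mem_vectorSpan q _ 0 1 hx₂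
    have hd : Disjoint {s : (S₁.disjSum S₂ : Finset (ι ⊕ κ)) | s.1.isLeft}
        {s : (S₁.disjSum S₂ : Finset (ι ⊕ κ)) | s.1.isRight} := by
      rw [Set.disjoint_left]
      rintro ⟨s | s, hs⟩ <;> simp
    have hdis := hli.disjoint_span_image hd
    refine cayMap_zero_injective (Submodule.disjoint_def.1 hdis _ ?_ ?_)
    · refine Submodule.span_mono ?_ e₁
      rintro _ ⟨i, hi, rfl⟩
      exact ⟨⟨Sum.inl i, Finset.inl_mem_disjSum.2 hi⟩, by simp, rfl⟩
    · refine Submodule.span_mono ?_ e₂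
      rintro _ ⟨i, hi, rfl⟩
      exact ⟨⟨Sum.inr i, Finset.inr_mem_disjSum.2 hi⟩, by simp, rfl⟩
  rw [setDim_convexHull, himg, vectorSpan_add_set ((Finset.coe_nonempty.2 h₁).image p)
    ((Finset.coe_nonempty.2 h₂).image q), Finset.card_disjSum]
  have := Submodule.finrank_sup_add_finrank_inf_eq (vectorSpan ℝ (p '' (S₁ : Set ι)))
    (vectorSpan ℝ (q '' (S₂ : Set κ)))
  rw [hinf, finrank_bot] at this
  omega

/-- Face numbers of a Minkowski sum whose Cayley configuration is generic on bases that meet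
both summands. -/
lemma faceCount_add_of_det [Fintype ι] [Fintype κ]
    (hcard : d + 2 < Fintype.card ι + Fintype.card κ)
    (hv : ∀ f : Fin (d + 2) → ι ⊕ κ, Function.Injective f → (∃ r i, f r = Sum.inl i) →
      (∃ r j, f r = Sum.inr j) → (Matrix.of fun r => cayConf p q (f r)).det ≠ 0)
    {k : ℕ} (hk1 : 1 ≤ k) (hkd : k ≤ d) :
    faceCount (convexHull ℝ (Set.range p) + convexHull ℝ (Set.range q)) (k - 1) =
      {S : Finset (ι ⊕ κ) | S.toLeft.Nonempty ∧ S.toRight.Nonempty ∧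
        IsFacial (cayConf p q) S ∧ S.card = k + 1}.ncard := by
  classical
  have hdim : ∀ (S₁ : Finset ι) (S₂ : Finset κ), S₁.Nonempty → S₂.Nonempty →
      (S₁.disjSum S₂).card ≤ d + 2 →
      setDim (convexHull ℝ (sumConf p q '' ((S₁ ×ˢ S₂ : Finset (ι × κ)) : Set (ι × κ)))) + 2 =
        (S₁.disjSum S₂).card := fun S₁ S₂ h₁ h₂ hc => by
    obtain ⟨f, hf, hfS, -⟩ := exists_injective_range_between (m := d + 2)
      (Finset.subset_univ (S₁.disjSum S₂)) hc
      (by rw [Finset.card_univ, Fintype.card_sum]; exact hcard.le)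
    refine setDim_convexHull_sumConf p q h₁ h₂
      (linearIndependent_subtype_of_det_ne_zero (cayConf p q) _ f (hv f hf ?_ ?_) hfS)
    · obtain ⟨i, hi⟩ := h₁
      obtain ⟨r, hr⟩ := hfS _ (Finset.inl_mem_disjSum.2 hi)
      exact ⟨r, i, hr⟩
    · obtain ⟨j, hj⟩ := h₂
      obtain ⟨r, hr⟩ := hfS _ (Finset.inr_mem_disjSum.2 hj)
      exact ⟨r, j, hr⟩
  rw [convexHull_range_add, faceCount_convexHull_range]
  symm
  refine Set.ncard_congr (fun S _ => S.toLeft ×ˢ S.toRight) ?_ ?_ ?_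
  · rintro S ⟨h₁, h₂, hS, hc⟩
    have hS' : S = S.toLeft.disjSum S.toRight := Finset.toLeft_disjSum_toRight.symm
    refine ⟨h₁.product h₂, fun hU => ?_, isFacial_product p q (hS' ▸ hS), ?_⟩
    · have h3 : S = Finset.univ := by
        refine Finset.eq_univ_of_forall ?_
        obtain ⟨i₀, -⟩ := h₁
        obtain ⟨j₀, -⟩ := h₂
        have hall : ∀ i j, i ∈ S.toLeft ∧ j ∈ S.toRight := fun i j => by
          rw [← Finset.mem_product (p := (i, j)), hU]; exact Finset.mem_univ _
        rintro (i | j)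
        · exact Finset.mem_toLeft.1 (hall i j₀).1
        · exact Finset.mem_toRight.1 (hall i₀ j).2
      rw [h3, Finset.card_univ, Fintype.card_sum] at hc
      omega
    · have := hdim _ _ h₁ h₂ (by rw [← hS']; omega)
      rw [← hS', hc] at this
      omega
  · rintro S T ⟨h₁, h₂, -, -⟩ ⟨h₃, h₄, -, -⟩ hST
    have hST : S.toLeft ×ˢ S.toRight = T.toLeft ×ˢ T.toRight := hST
    rw [← Finset.toLeft_disjSum_toRight (u := S), ← Finset.toLeft_disjSum_toRight (u := T)]
    obtain ⟨i₀, hi₀⟩ := h₁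
    obtain ⟨j₀, hj₀⟩ := h₂
    have hmem : ∀ i j, (i ∈ S.toLeft ∧ j ∈ S.toRight) ↔ (i ∈ T.toLeft ∧ j ∈ T.toRight) :=
      fun i j => by
        rw [← Finset.mem_product (p := (i, j)), hST, Finset.mem_product]
    have h0 := (hmem i₀ j₀).1 ⟨hi₀, hj₀⟩
    congr 1
    · ext i
      exact ⟨fun h => ((hmem i j₀).1 ⟨h, hj₀⟩).1, fun h => ((hmem i j₀).2 ⟨h, h0.2⟩).1⟩
    · ext j
      exact ⟨fun h => ((hmem i₀ j).1 ⟨hi₀, h⟩).2, fun h => ((hmem i₀ j).2 ⟨h0.1, h⟩).2⟩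
  · rintro S' ⟨hne, hU, hS', hk'⟩
    obtain ⟨S₁, S₂, h₁, h₂, rfl, hS⟩ := exists_isFacial_of_product p q hne hS'
    refine ⟨S₁.disjSum S₂, ⟨by simpa using h₁, by simpa using h₂, hS, ?_⟩, by simp⟩
    obtain ⟨i₀, hi₀⟩ := id h₁
    obtain ⟨j₀, hj₀⟩ := id h₂
    have hlt : (S₁.disjSum S₂).card < d + 2 := by
      refine hS.card_lt (S₀ := {Sum.inl i₀, Sum.inr j₀}) ?_ (fun f hf hfS => ?_) ?_ ?_
      · rw [Finset.card_pair (by simp)]; omega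
      · obtain ⟨r, hr⟩ := hfS (Sum.inl i₀) (by simp)
        obtain ⟨r', hr'⟩ := hfS (Sum.inr j₀) (by simp)
        exact hv f hf ⟨r, i₀, hr⟩ ⟨r', j₀, hr'⟩
      · intro x hx
        rw [Finset.mem_insert, Finset.mem_singleton] at hx
        rcases hx with rfl | rfl <;> simpa
      · intro h
        refine hU (Finset.eq_univ_of_forall fun x => Finset.mem_product.2 ⟨?_, ?_⟩)
        · exact Finset.inl_mem_disjSum.1 (h ▸ Finset.mem_univ (Sum.inl x.1))
        · exact Finset.inr_mem_disjSum.1 (h ▸ Finset.mem_univ (Sum.inr x.2))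
    have := hdim S₁ S₂ h₁ h₂ hlt.le
    omega

end MinkowskiSum

section SignComparison

open Matrix Filter Topology

lemma sign_det_vandermonde_eq {m : ℕ} {s t : Fin m → ℝ} (h : ∀ i j, s i < s j ↔ t i < t j) :
    SignType.sign (Matrix.vandermonde s).det = SignType.sign (Matrix.vandermonde t).det := by
  have hs : ∀ u : Fin m → ℝ, SignType.sign (Matrix.vandermonde u).det =
      ∏ i, ∏ j ∈ Finset.Ioi i, SignType.sign (u j - u i) := fun u => by
    rw [Matrix.det_vandermonde, ← signHom_apply, map_prod]
    simp only [map_prod, signHom_apply]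
  rw [hs, hs]
  refine Finset.prod_congr rfl fun i _ => Finset.prod_congr rfl fun j _ => ?_
  rcases lt_trichotomy (s i) (s j) with hij | hij | hij
  · rw [sign_pos (sub_pos.2 hij), sign_pos (sub_pos.2 ((h i j).1 hij))]
  · have : t i = t j := le_antisymm (not_lt.1 fun h' => ((h j i).2 h').ne' hij)
      (not_lt.1 fun h' => ((h i j).2 h').ne hij)
    rw [hij, this, sub_self, sub_self]
  · rw [sign_neg (sub_neg.2 hij), sign_neg (sub_neg.2 ((h j i).1 hij))]

variable {ι κ : Type*} {d : ℕ}

/-- The exponent of the `r`-th coordinate of a point of the left or right curve. -/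
def curveExp (d : ℕ) (s : ι ⊕ κ) (r : Fin (d + 2)) : ℕ :=
  s.elim (fun _ => r) (fun _ => d + 1 - r)

/-- The leading matrix of the determinants of the two-curve configuration, for bases with `k`
points on the left curve. -/
def blockMatrix (z : ι ⊕ κ → ℝ) (f : Fin (d + 2) → ι ⊕ κ) (k : ℕ) :
    Matrix (Fin (d + 2)) (Fin (d + 2)) ℝ :=
  Matrix.of fun r c => if (f r).isLeft = decide ((c : ℕ) < k) then z (f r) ^ curveExp d (f r) c
    else 0

lemma coeff_eq_zero_of_forall_sum_eq_zero {m : ℕ} {α : Type*} (A : Finset α) (z : α → ℝ)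
    (hz : Set.InjOn z A) (C : Finset (Fin m)) (e : Fin m → ℕ) (he : Set.InjOn e C)
    (heA : ∀ c ∈ C, e c < A.card) (v : Fin m → ℝ)
    (h : ∀ a ∈ A, ∑ c ∈ C, z a ^ e c * v c = 0) : ∀ c ∈ C, v c = 0 := by
  have hP : (∑ c ∈ C, Polynomial.monomial (e c) (v c) : Polynomial ℝ) = 0 := by
    refine Polynomial.eq_zero_of_degree_lt_of_eval_index_eq_zero (s := A) (v := z) hz ?_
      fun a ha => ?_
    · refine (Polynomial.degree_sum_le _ _).trans_lt ((Finset.sup_lt_iff ?_).2 fun c hc => ?_)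
      · exact WithBot.bot_lt_coe _
      · exact (Polynomial.degree_monomial_le _ _).trans_lt (by exact_mod_cast heA c hc)
    · rw [Polynomial.eval_finsetSum, ← h a ha]
      exact Finset.sum_congr rfl fun c _ => by rw [Polynomial.eval_monomial, mul_comm]
  intro c hc
  have := congrArg (fun P => P.coeff (e c)) hP
  simp only [Polynomial.finsetSum_coeff, Polynomial.coeff_monomial, Polynomial.coeff_zero] at this
  rw [Finset.sum_eq_single_of_mem c hc fun b hb hbc => if_neg fun h => hbc (he hb hc h)] at this
  simpa using this

lemma det_blockMatrix_ne_zero {z : ι ⊕ κ → ℝ} (hl : Function.Injective fun i => z (Sum.inl i))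
    (hr : Function.Injective fun j => z (Sum.inr j)) {f : Fin (d + 2) → ι ⊕ κ}
    (hf : Function.Injective f) :
    (blockMatrix z f (Finset.univ.filter fun r => (f r).isLeft).card).det ≠ 0 := by
  set k := (Finset.univ.filter fun r => (f r).isLeft).card with hk
  have hk' : (Finset.univ.filter fun r => ¬ (f r).isLeft).card = d + 2 - k := by
    have := Finset.card_filter_add_card_filter_not (s := (Finset.univ : Finset (Fin (d + 2))))
      (fun r => (f r).isLeft = true)
    rw [Finset.card_univ, Fintype.card_fin] at this
    omega
  intro h0
  obtain ⟨v, hv, hMv⟩ := Matrix.exists_mulVec_eq_zero_iff.2 h0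
  have hrow : ∀ r, ∑ c, blockMatrix z f k r c * v c = 0 := fun r => congrFun hMv r
  have hsum : ∀ r, ∑ c ∈ Finset.univ.filter (fun c : Fin (d + 2) =>
      (f r).isLeft = decide ((c : ℕ) < k)), z (f r) ^ curveExp d (f r) c * v c = 0 := fun r => by
    rw [Finset.sum_filter]
    refine (Finset.sum_congr rfl fun c _ => ?_).trans (hrow r)
    simp only [blockMatrix, Matrix.of_apply]
    split_ifs <;> simp
  refine hv (funext fun c => ?_)
  by_cases hc : (c : ℕ) < k
  · refine coeff_eq_zero_of_forall_sum_eq_zero (Finset.univ.filter fun r => (f r).isLeft = true)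
      (fun r => z (f r)) ?_ (Finset.univ.filter fun c : Fin (d + 2) => (c : ℕ) < k)
      (fun c => (c : ℕ)) Fin.val_injective.injOn ?_ v ?_ c (by simpa using hc)
    · intro r hr r' hr' h
      simp only [Finset.coe_filter, Finset.mem_univ, true_and, Set.mem_ofPred_eq] at hr hr'
      obtain ⟨i, hi⟩ := Sum.isLeft_iff.1 hr
      obtain ⟨i', hi'⟩ := Sum.isLeft_iff.1 hr'
      simp only [hi, hi'] at h
      exact hf (by rw [hi, hi', hl h])
    · intro c hc
      rw [← hk]
      simpa using hc
    · intro r hr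
      simp only [Finset.mem_filter, Finset.mem_univ, true_and] at hr
      obtain ⟨i, hi⟩ := Sum.isLeft_iff.1 hr
      have := hsum r
      simpa [hi, curveExp] using this
  · refine coeff_eq_zero_of_forall_sum_eq_zero (Finset.univ.filter fun r => ¬ (f r).isLeft = true)
      (fun r => z (f r)) ?_ (Finset.univ.filter fun c : Fin (d + 2) => ¬ (c : ℕ) < k)
      (fun c => d + 1 - (c : ℕ)) ?_ ?_ v ?_ c (by simpa using hc)
    · intro r hr' r' hr'' h
      simp only [Finset.coe_filter, Finset.mem_univ, true_and, Set.mem_ofPred_eq,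
        Sum.not_isLeft] at hr' hr''
      obtain ⟨i, hi⟩ := Sum.isRight_iff.1 hr'
      obtain ⟨i', hi'⟩ := Sum.isRight_iff.1 hr''
      simp only [hi, hi'] at h
      exact hf (by rw [hi, hi', hr h])
    · intro c _ c' _ h
      have := c.is_lt
      have := c'.is_lt
      simp only at h
      exact Fin.ext (by omega)
    · intro c hc
      have hc : ¬ (c : ℕ) < k := by simpa using hc
      have := c.is_lt
      rw [hk']
      omega
    · intro r hr'
      simp only [Finset.mem_filter, Finset.mem_univ, true_and, Sum.not_isLeft] at hr'
      obtain ⟨i, hi⟩ := Sum.isRight_iff.1 hr'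
      have := hsum r
      simpa [hi, curveExp] using this

/-- For small `τ`, the sign of a determinant of the two-curve configuration is that of its
leading matrix, whatever the weights `a` outside the leading blocks are. -/
lemma eventually_sign_det_eq (a : ι ⊕ κ → Fin (d + 2) → ℝ) (z : ι ⊕ κ → ℝ)
    (hl : Function.Injective fun i => z (Sum.inl i))
    (hr : Function.Injective fun j => z (Sum.inr j))
    (hal : ∀ i r, r ≠ Fin.last _ → a (Sum.inl i) r = 1)
    (har : ∀ j r, r ≠ 0 → a (Sum.inr j) r = 1)
    {f : Fin (d + 2) → ι ⊕ κ} (hf : Function.Injective f) (hfl : ∃ r i, f r = Sum.inl i)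
    (hfr : ∃ r j, f r = Sum.inr j) :
    ∀ᶠ τ in 𝓝[>] (0 : ℝ), SignType.sign
      (Matrix.of fun r c => a (f r) c * (τ * z (f r)) ^ curveExp d (f r) c).det =
      SignType.sign (blockMatrix z f (Finset.univ.filter fun r => (f r).isLeft).card).det := by
  have hB := det_blockMatrix_ne_zero (d := d) hl hr hf
  set k := (Finset.univ.filter fun r => (f r).isLeft).card with hk
  have hk0 : 0 < k := by
    obtain ⟨r, i, hri⟩ := hfl
    exact Finset.card_pos.2 ⟨r, by simp [hri]⟩
  have hk1 : k < d + 2 := by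
    obtain ⟨r, j, hrj⟩ := hfr
    have : k < (Finset.univ : Finset (Fin (d + 2))).card :=
      Finset.card_lt_card (Finset.filter_ssubset.2 ⟨r, Finset.mem_univ _, by simp [hrj]⟩)
    simpa using this
  let m : Fin (d + 2) → Fin (d + 2) → ℕ := fun r c =>
    if (f r).isLeft then 2 * c + 1 - 2 * k else 2 * k - (2 * c + 1)
  let M : ℝ → Matrix (Fin (d + 2)) (Fin (d + 2)) ℝ := fun τ =>
    Matrix.of fun r c => a (f r) c * z (f r) ^ curveExp d (f r) c * τ ^ m r c
  let u : Fin (d + 2) → ℤ := fun c => if (c : ℕ) < k then c else 2 * k - 1 - c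
  let w : Fin (d + 2) → ℤ := fun r => if (f r).isLeft then 0 else d + 2 - 2 * k
  have hexp : ∀ r c, (curveExp d (f r) c : ℤ) = w r + u c + m r c := fun r c => by
    have := c.is_lt
    rcases hfr' : f r with i | j
    · simp only [curveExp, Sum.elim_inl, w, u, m, hfr', Sum.isLeft_inl, if_true]
      split_ifs <;> omega
    · simp only [curveExp, Sum.elim_inr, w, u, m, hfr', Sum.isLeft_inr, Bool.false_eq_true,
        if_false]
      split_ifs <;> omega
  have hM0 : M 0 = blockMatrix z f k := by
    ext r c
    have := c.is_lt
    simp only [M, blockMatrix, Matrix.of_apply]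
    rcases hfr' : f r with i | j
    · by_cases hc : (c : ℕ) < k
      · have hm : m r c = 0 := by simp only [m, hfr', Sum.isLeft_inl, if_true]; omega
        rw [hal i c (by rintro rfl; simp at hc; omega), hm]
        simp [hc]
      · have hm : m r c ≠ 0 := by simp only [m, hfr', Sum.isLeft_inl, if_true]; omega
        simp [hc, hm]
    · by_cases hc : (c : ℕ) < k
      · have hm : m r c ≠ 0 := by simp [m, hfr']; omega
        simp [hc, hm]
      · have hm : m r c = 0 := by simp [m, hfr']; omega
        rw [har j c (by rintro rfl; simp at hc; omega), hm]
        simp [hc]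
  have hcont : Continuous fun τ => (M τ).det := by
    refine Continuous.matrix_det (continuous_matrix fun r c => ?_)
    simp only [M, Matrix.of_apply]
    fun_prop
  have hev : ∀ᶠ τ in 𝓝 (0 : ℝ), SignType.sign (M τ).det = SignType.sign (M 0).det := by
    have h0 : (M 0).det ≠ 0 := by rwa [hM0]
    rcases lt_or_gt_of_ne h0 with h | h
    · filter_upwards [hcont.continuousAt.eventually_lt_const h] with τ hτ
      rw [sign_neg h, sign_neg hτ]
    · filter_upwards [hcont.continuousAt.eventually_const_lt h] with τ hτ
      rw [sign_pos h, sign_pos hτ]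
  filter_upwards [hev.filter_mono nhdsWithin_le_nhds, self_mem_nhdsWithin] with τ hτ hpos
  have hpos : 0 < τ := hpos
  have hdet : (Matrix.of fun r c => a (f r) c * (τ * z (f r)) ^ curveExp d (f r) c).det =
      (∏ r, τ ^ w r) * ((∏ c, τ ^ u c) * (M τ).det) := by
    rw [← Matrix.det_mul_row, ← Matrix.det_mul_column]
    congr 1
    ext r c
    simp only [Matrix.of_apply, M]
    have : τ ^ curveExp d (f r) c = τ ^ w r * τ ^ u c * τ ^ m r c := by
      rw [← zpow_natCast, hexp, zpow_add₀ hpos.ne', zpow_add₀ hpos.ne', zpow_natCast]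
    rw [mul_pow, this]
    ring
  rw [hdet, sign_mul, sign_mul, sign_pos (Finset.prod_pos fun r _ => zpow_pos hpos _),
    sign_pos (Finset.prod_pos fun r _ => zpow_pos hpos _), one_mul, one_mul, hτ, hM0]

lemma cayConf_momentCurve (x : ι → ℝ) (y : κ → ℝ) (τ : ℝ) (s : ι ⊕ κ) (c : Fin (d + 2)) :
    cayConf (fun i => momentCurve d (τ * x i)) (fun j => momentCurve d (τ * y j) ∘ Fin.rev) s c =
      (if s.isLeft then if c = Fin.last _ then 0 else 1 else if c = 0 then 0 else 1) *
        (τ * Sum.elim x y s) ^ curveExp d s c := by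
  rcases s with i | j
  · refine Fin.cases ?_ (fun c => ?_) c
    · have : (0 : Fin (d + 2)) ≠ Fin.last _ := (Fin.last_pos).ne
      simp [cayConf, cayMap, curveExp, this]
    · refine Fin.lastCases ?_ (fun c => ?_) c
      · simp [cayConf, cayMap]
      · have : c.castSucc.succ ≠ Fin.last (d + 1) := by
          rw [← Fin.succ_last, Ne, Fin.succ_inj]
          exact (Fin.castSucc_lt_last c).ne
        simp [cayConf, cayMap, curveExp, momentCurve, this]
  · refine Fin.cases ?_ (fun c => ?_) c
    · simp [cayConf, cayMap]
    · refine Fin.lastCases ?_ (fun c => ?_) c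
      · simp [cayConf, cayMap, curveExp]
      · have : d - (c + 1) + 1 = d - (c : ℕ) := by omega
        simp [cayConf, cayMap, curveExp, momentCurve, this]

lemma homog_momentCurve {α : Type*} (D : ℕ) (T : α → ℝ) (s : α) :
    homog (fun s => momentCurve D (T s)) s = fun r : Fin (D + 1) => T s ^ (r : ℕ) := by
  ext r
  refine Fin.cases ?_ (fun r => ?_) r <;> simp [homog, momentCurve]

lemma of_homog_momentCurve {α : Type*} (D : ℕ) (T : α → ℝ) (f : Fin (D + 1) → α) :
    (Matrix.of fun r => homog (fun s => momentCurve D (T s)) (f r)) =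
      Matrix.vandermonde fun r => T (f r) := by
  ext r c
  rw [Matrix.of_apply, homog_momentCurve, Matrix.vandermonde_apply]

/-- Two opposite moment curves, sufficiently shrunk, have the same mixed chirotope in their
Cayley configuration as a single moment curve. -/
lemma exists_sign_det_cayConf_eq [Finite ι] [Finite κ] {x : ι → ℝ} {y : κ → ℝ}
    (hy : ∀ j, 0 < y j) (hxi : Function.Injective x)
    (hyi : Function.Injective y) {T : ι ⊕ κ → ℝ}
    (hTl : ∀ i i', T (Sum.inl i) < T (Sum.inl i') ↔ x i < x i')
    (hTr : ∀ j j', T (Sum.inr j) < T (Sum.inr j') ↔ y j' < y j)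
    (hTlr : ∀ i j, T (Sum.inl i) < T (Sum.inr j)) :
    ∃ τ : ℝ, 0 < τ ∧ ∀ f : Fin (d + 2) → ι ⊕ κ, Function.Injective f →
      (∃ r i, f r = Sum.inl i) → (∃ r j, f r = Sum.inr j) →
      SignType.sign (Matrix.of fun r => cayConf (fun i => momentCurve d (τ * x i))
        (fun j => momentCurve d (τ * y j) ∘ Fin.rev) (f r)).det =
      SignType.sign (Matrix.of fun r => homog (fun s => momentCurve (d + 1) (T s)) (f r)).det := by
  have hsmall : ∀ᶠ τ in 𝓝[>] (0 : ℝ), ∀ i j, τ * x i < (τ * y j)⁻¹ := by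
    refine eventually_all.2 fun i => eventually_all.2 fun j => ?_
    have hc : Continuous fun τ : ℝ => τ * x i * (τ * y j) := by fun_prop
    have : ∀ᶠ τ in 𝓝 (0 : ℝ), τ * x i * (τ * y j) < 1 :=
      hc.continuousAt.eventually_lt_const (by simp)
    filter_upwards [this.filter_mono nhdsWithin_le_nhds, self_mem_nhdsWithin] with τ hτ hpos
    rwa [← one_div, lt_div_iff₀ (mul_pos hpos (hy j))]
  have hsign : ∀ a : ι ⊕ κ → Fin (d + 2) → ℝ,
      (∀ i r, r ≠ Fin.last _ → a (Sum.inl i) r = 1) →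
      (∀ j r, r ≠ 0 → a (Sum.inr j) r = 1) → ∀ᶠ τ in 𝓝[>] (0 : ℝ),
      ∀ f : Fin (d + 2) → ι ⊕ κ, Function.Injective f →
      (∃ r i, f r = Sum.inl i) → (∃ r j, f r = Sum.inr j) → SignType.sign
      (Matrix.of fun r c => a (f r) c * (τ * Sum.elim x y (f r)) ^ curveExp d (f r) c).det =
      SignType.sign (blockMatrix (Sum.elim x y) f
        (Finset.univ.filter fun r => (f r).isLeft).card).det := fun a hal har => by
    refine eventually_all.2 fun f => ?_
    by_cases hf : Function.Injective f ∧ (∃ r i, f r = Sum.inl i) ∧ ∃ r j, f r = Sum.inr j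
    · filter_upwards [eventually_sign_det_eq a (Sum.elim x y) hxi hyi hal har hf.1 hf.2.1 hf.2.2]
        with τ hτ _ _ _ using hτ
    · exact Eventually.of_forall fun τ h1 h2 h3 => absurd ⟨h1, h2, h3⟩ hf
  obtain ⟨τ, ⟨⟨hτ0, hτ1⟩, hτ2⟩, hτ⟩ := (((hsmall.and
    (hsign (fun s c => if s.isLeft then if c = Fin.last _ then 0 else 1 else
      if c = 0 then 0 else 1) (fun i r hr => by simp [hr]) (fun j r hr => by simp [hr]))).and
    (hsign (fun _ _ => 1) (fun _ _ _ => rfl) (fun _ _ _ => rfl))).and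
      self_mem_nhdsWithin).exists
  have hτ : 0 < τ := hτ
  refine ⟨τ, hτ, fun f hf hfl hfr => ?_⟩
  let T' : ι ⊕ κ → ℝ := Sum.elim (fun i => τ * x i) (fun j => (τ * y j)⁻¹)
  have hTT' : ∀ s t, T s < T t ↔ T' s < T' t := by
    rintro (i | j) (i' | j')
    · simp only [hTl, T', Sum.elim_inl, mul_lt_mul_iff_right₀ hτ]
    · exact iff_of_true (hTlr i j') (hτ0 i j')
    · exact iff_of_false (hTlr i' j).not_gt (hτ0 i' j).not_gt
    · simp only [hTr, T', Sum.elim_inr, inv_lt_inv₀ (mul_pos hτ (hy j)) (mul_pos hτ (hy j')),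
        mul_lt_mul_iff_right₀ hτ]
  have hcay : (Matrix.of fun r => cayConf (fun i => momentCurve d (τ * x i))
      (fun j => momentCurve d (τ * y j) ∘ Fin.rev) (f r)) = Matrix.of fun r c =>
        (if (f r).isLeft then if c = Fin.last _ then 0 else 1 else if c = 0 then 0 else 1) *
        (τ * Sum.elim x y (f r)) ^ curveExp d (f r) c := by
    ext r c
    simp only [Matrix.of_apply, cayConf_momentCurve]
  let b : ι ⊕ κ → ℝ := Sum.elim 1 fun j => (τ * y j)⁻¹ ^ (d + 1)
  have hb : ∀ s, 0 < b s := by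
    rintro (i | j)
    · exact one_pos
    · exact pow_pos (inv_pos.2 (mul_pos hτ (hy j))) _
  have hvan : (Matrix.vandermonde fun r => T' (f r)).det = (∏ r, b (f r)) *
      (Matrix.of fun r c => (1 : ℝ) * (τ * Sum.elim x y (f r)) ^ curveExp d (f r) c).det := by
    rw [← Matrix.det_mul_column]
    congr 1
    ext r c
    simp only [Matrix.vandermonde_apply, Matrix.of_apply, one_mul]
    rcases f r with i | j
    · simp [T', b, curveExp]
    · have h0 : τ * y j ≠ 0 := (mul_pos hτ (hy j)).ne'
      have hc : d + 1 = (d + 1 - c) + c := by have := c.is_lt; omega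
      simp only [T', b, curveExp, Sum.elim_inr]
      rw [inv_pow, inv_pow, ← div_eq_inv_mul, eq_div_iff (pow_ne_zero _ h0),
        inv_mul_eq_div, div_eq_iff (pow_ne_zero _ h0), ← pow_add, ← hc]
  rw [hcay, hτ1 f hf hfl hfr, ← hτ2 f hf hfl hfr, of_homog_momentCurve,
    sign_det_vandermonde_eq fun r r' => hTT' (f r) (f r'), hvan, sign_mul,
    sign_pos (Finset.prod_pos fun r _ => hb (f r)), one_mul]

end SignComparison

section EvennessCount

open Matrix Polynomial

/-- The minimal number of pairs of consecutive integers needed to cover `A ∩ {0, …, n-1}`. -/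
def pairCover (A : Finset ℕ) : ℕ → ℕ
  | 0 => 0
  | 1 => if 0 ∈ A then 1 else 0
  | n + 2 => if n + 1 ∈ A then pairCover A n + 1 else pairCover A (n + 1)

lemma pairCover_congr {A B : Finset ℕ} :
    ∀ n, (∀ i < n, i ∈ A ↔ i ∈ B) → pairCover A n = pairCover B n
  | 0, _ => rfl
  | 1, h => by simp only [pairCover, h 0 one_pos]
  | n + 2, h => by
    simp only [pairCover, h (n + 1) (by omega),
      pairCover_congr n fun i hi => h i (by omega),
      pairCover_congr (n + 1) fun i hi => h i (by omega)]

lemma two_mul_pairCover_le (A : Finset ℕ) : ∀ n, 2 * pairCover A n ≤ n + 1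
  | 0 => by simp [pairCover]
  | 1 => by simp only [pairCover]; split_ifs <;> omega
  | n + 2 => by
    have h1 := two_mul_pairCover_le A n
    have h2 := two_mul_pairCover_le A (n + 1)
    simp only [pairCover]
    split_ifs <;> omega

/-- A polynomial that vanishes on `A` and is positive elsewhere on `1, …, n` and at some later
point has degree at least `2 * pairCover A n - 1`. -/
lemma two_mul_pairCover_le_natDegree (A : Finset ℕ) : ∀ (n : ℕ) (p : ℝ[X]) (c : ℝ), (n : ℝ) < c →
    0 < p.eval c → (∀ i < n, 0 ≤ p.eval ((i : ℝ) + 1)) →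
    (∀ i < n, p.eval ((i : ℝ) + 1) = 0 ↔ i ∈ A) → 2 * pairCover A n ≤ p.natDegree + 1
  | 0, _, _, _, _, _, _ => by simp [pairCover]
  | 1, p, c, _, hpc, _, hp => by
    simp only [pairCover]
    split_ifs with h0
    · have h1 := (hp 0 one_pos).2 h0
      by_contra! hlt
      have hdeg : p.natDegree = 0 := by omega
      rw [eq_C_of_natDegree_eq_zero hdeg, eval_C] at h1 hpc
      exact hpc.ne' h1
    · omega
  | n + 2, p, c, hc, hpc, hp0, hp => by
    push_cast at hc
    by_cases hn : n + 1 ∈ A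
    · have hroot := (hp (n + 1) (by omega)).2 hn
      obtain ⟨q, rfl⟩ := dvd_iff_isRoot.2 hroot
      have hq1 : q.eval ((n : ℝ) + 1) ≤ 0 := by
        have := hp0 n (by omega)
        simp only [eval_mul, eval_sub, eval_X, eval_C] at this
        push_cast at this
        linarith
      have hqc : 0 < q.eval c := by
        simp only [eval_mul, eval_sub, eval_X, eval_C] at hpc
        push_cast at hpc
        exact pos_of_mul_pos_right hpc (by linarith)
      obtain ⟨ρ, ⟨hρ1, hρ2⟩, hρ⟩ := intermediate_value_Icc (by linarith : (n : ℝ) + 1 ≤ c)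
        q.continuousOn (show (0 : ℝ) ∈ Set.Icc _ _ from ⟨hq1, hqc.le⟩)
      have hρc : ρ < c := lt_of_le_of_ne hρ2 (by rintro rfl; exact hqc.ne' hρ)
      obtain ⟨r, rfl⟩ := dvd_iff_isRoot.2 (show q.IsRoot ρ from hρ)
      have hr : ∀ t : ℝ, t < n + 1 → ∃ a : ℝ, 0 < a ∧
          ((X - C (((n + 1 : ℕ) : ℝ) + 1)) * ((X - C ρ) * r)).eval t = a * r.eval t :=
        fun t ht => ⟨(t - (n + 1 + 1)) * (t - ρ),
          mul_pos_of_neg_of_neg (by linarith) (by linarith), by simp; ring⟩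
      have hlt : ∀ i < n, (i : ℝ) + 1 < n + 1 := fun i hi => by
        have : (i : ℝ) < n := by exact_mod_cast hi
        linarith
      have hrc : 0 < r.eval c := by
        simp only [eval_mul, eval_sub, eval_X, eval_C] at hqc
        exact pos_of_mul_pos_right hqc (by linarith)
      have ih := two_mul_pairCover_le_natDegree A n r c (by linarith) hrc
        (fun i hi => by
          obtain ⟨a, ha, h⟩ := hr _ (hlt i hi)
          have := hp0 i (by omega)
          rw [h] at this
          exact nonneg_of_mul_nonneg_right this ha)
        (fun i hi => by
          obtain ⟨a, ha, h⟩ := hr _ (hlt i hi)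
          rw [← hp i (by omega), h, mul_eq_zero, or_iff_right ha.ne'])
      have hr0 : r ≠ 0 := by rintro rfl; simp at hrc
      rw [natDegree_mul (X_sub_C_ne_zero _) (mul_ne_zero (X_sub_C_ne_zero _) hr0),
        natDegree_mul (X_sub_C_ne_zero _) hr0, natDegree_X_sub_C, natDegree_X_sub_C]
      simp only [pairCover, hn, if_true]
      omega
    · simp only [pairCover, hn, if_false]
      have hpn : p.eval ((n : ℝ) + 1 + 1) ≠ 0 := fun h => hn ((hp (n + 1) (by omega)).1 (by
        push_cast; exact h))
      have hpn' := hp0 (n + 1) (by omega)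
      push_cast at hpn'
      exact two_mul_pairCover_le_natDegree A (n + 1) p _ (by push_cast; linarith)
        (lt_of_le_of_ne hpn' hpn.symm) (fun i hi => hp0 i (by omega)) fun i hi => hp i (by omega)

lemma exists_polynomial_pairCover (A : Finset ℕ) : ∀ n : ℕ, ∃ p : ℝ[X],
    p.natDegree ≤ 2 * pairCover A n ∧ (∀ i : ℕ, 0 ≤ p.eval ((i : ℝ) + 1)) ∧
    ∀ i : ℕ, p.eval ((i : ℝ) + 1) = 0 ↔ i < n ∧ i ∈ A
  | 0 => ⟨1, by simp, by simp, by simp⟩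
  | 1 => by
    by_cases h : 0 ∈ A
    · refine ⟨(X - C 1) ^ 2, ?_, fun i => by simp, fun i => ?_⟩
      · rw [natDegree_pow, natDegree_X_sub_C]
        simp [pairCover, h]
      · simp only [eval_pow, eval_sub, eval_X, eval_C, add_sub_cancel_right,
          pow_eq_zero_iff two_ne_zero, Nat.cast_eq_zero, Nat.lt_one_iff]
        exact ⟨by rintro rfl; exact ⟨rfl, h⟩, fun h => h.1⟩
    · refine ⟨1, by simp, by simp, fun i => ?_⟩
      simp only [eval_one, one_ne_zero, Nat.lt_one_iff, false_iff]
      rintro ⟨rfl, h'⟩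
      exact h h'
  | n + 2 => by
    by_cases hn : n + 1 ∈ A
    · obtain ⟨p, hpd, hp0, hp⟩ := exists_polynomial_pairCover A n
      let b : ℕ := if n ∈ A then n else n + 1
      have hfac : ∀ i : ℕ, ((X - C ((n : ℝ) + 2)) * (X - C ((b : ℝ) + 1)) * p).eval ((i : ℝ) + 1) =
          ((i : ℝ) - (n + 1 : ℕ)) * ((i : ℝ) - b) * p.eval ((i : ℝ) + 1) := fun i => by
        simp only [eval_mul, eval_sub, eval_X, eval_C]
        push_cast
        ring
      refine ⟨(X - C ((n : ℝ) + 2)) * (X - C ((b : ℝ) + 1)) * p, ?_, fun i => ?_, fun i => ?_⟩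
      · refine natDegree_mul_le.trans ?_
        rw [natDegree_mul (X_sub_C_ne_zero _) (X_sub_C_ne_zero _), natDegree_X_sub_C,
          natDegree_X_sub_C]
        simp only [pairCover, hn, if_true]
        omega
      · rw [hfac]
        refine mul_nonneg ?_ (hp0 i)
        have hb : n ≤ b ∧ b ≤ n + 1 := by simp only [b]; split_ifs <;> omega
        rcases Nat.lt_or_ge i (n + 1) with hi | hi
        · refine mul_nonneg_of_nonpos_of_nonpos (sub_nonpos.2 ?_) (sub_nonpos.2 ?_) <;>
            exact_mod_cast (by omega)
        · refine mul_nonneg (sub_nonneg.2 ?_) (sub_nonneg.2 ?_) <;> exact_mod_cast (by omega)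
      · rw [hfac, mul_eq_zero, mul_eq_zero, sub_eq_zero, sub_eq_zero, hp, Nat.cast_inj,
          Nat.cast_inj]
        constructor
        · rintro ((rfl | rfl) | h)
          · exact ⟨by omega, hn⟩
          · simp only [b]
            split_ifs with h
            · exact ⟨by omega, h⟩
            · exact ⟨by omega, hn⟩
          · exact ⟨by omega, h.2⟩
        · rintro ⟨h1, h2⟩
          by_cases h3 : i < n
          · exact Or.inr ⟨h3, h2⟩
          · by_cases h4 : i = n + 1
            · exact Or.inl (Or.inl h4)
            · have : i = n := by omega
              subst this
              exact Or.inl (Or.inr (by simp [b, h2]))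
    · obtain ⟨p, hpd, hp0, hp⟩ := exists_polynomial_pairCover A (n + 1)
      refine ⟨p, by simpa only [pairCover, hn, if_false] using hpd, hp0, fun i => ?_⟩
      rw [hp]
      constructor
      · exact fun h => ⟨by omega, h.2⟩
      · rintro ⟨h1, h2⟩
        refine ⟨?_, h2⟩
        have : i ≠ n + 1 := by rintro rfl; exact hn h2
        omega

/-- The generating function, by cardinality, of the subsets of `{0, …, n-1}` covered by `m` pairs
of consecutive integers. -/
def coverGen (n m : ℕ) : ℕ[X] :=
  ∑ A ∈ (Finset.range n).powerset, if pairCover A n ≤ m then X ^ A.card else 0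

lemma coverGen_zero_right : ∀ n, coverGen n 0 = 1
  | 0 => by simp [coverGen, pairCover]
  | 1 => by
    rw [coverGen, Finset.range_one, ← insert_empty_eq, Finset.sum_powerset_insert (by simp)]
    simp [pairCover]
  | n + 2 => by
    rw [← coverGen_zero_right (n + 1), coverGen, coverGen, Finset.range_add_one,
      Finset.sum_powerset_insert (by simp)]
    refine (congrArg₂ (· + ·) (Finset.sum_congr rfl fun A hA => ?_)
      (Finset.sum_eq_zero fun A _ => ?_)).trans (add_zero _)
    · have : n + 1 ∉ A := fun h => by simpa using Finset.mem_powerset.1 hA h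
      simp only [pairCover, this, if_false]
    · simp [pairCover]

lemma coverGen_add_two (n m : ℕ) :
    coverGen (n + 2) (m + 1) = coverGen (n + 1) (m + 1) + X * (1 + X) * coverGen n m := by
  rw [coverGen, Finset.range_add_one, Finset.sum_powerset_insert (by simp)]
  congr 1
  · refine Finset.sum_congr rfl fun A hA => ?_
    have : n + 1 ∉ A := fun h => by simpa using Finset.mem_powerset.1 hA h
    simp only [pairCover, this, if_false]
  · rw [Finset.range_add_one, Finset.sum_powerset_insert (by simp), coverGen,
      ← Finset.sum_add_distrib, Finset.mul_sum]
    refine Finset.sum_congr rfl fun A hA => ?_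
    have hA : ∀ i ∈ A, i < n := fun i hi => by simpa using Finset.mem_powerset.1 hA hi
    have hn : n ∉ A := fun h => (hA _ h).false
    have hn1 : n + 1 ∉ insert n A := fun h => by
      rcases Finset.mem_insert.1 h with h | h
      · omega
      · have := hA _ h; omega
    have hn1' : n + 1 ∉ A := fun h => hn1 (Finset.mem_insert_of_mem h)
    have c1 : pairCover (insert (n + 1) A) n = pairCover A n := pairCover_congr n fun i hi => by
      rw [Finset.mem_insert, or_iff_right (by omega)]
    have c2 : pairCover (insert (n + 1) (insert n A)) n = pairCover A n :=
      pairCover_congr n fun i hi => by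
        rw [Finset.mem_insert, or_iff_right (by omega), Finset.mem_insert, or_iff_right (by omega)]
    simp only [pairCover, Finset.mem_insert_self, if_true, c1, c2,
      Finset.card_insert_of_notMem hn1, Finset.card_insert_of_notMem hn1',
      Finset.card_insert_of_notMem hn, add_le_add_iff_right]
    split_ifs
    · ring
    · simp

lemma coverGen_two_mul (m : ℕ) : coverGen (2 * m) m = (1 + X) ^ (2 * m) := by
  rw [coverGen, add_comm, ← Finset.card_range (2 * m)]
  conv_rhs => rw [← Finset.prod_const, Finset.prod_add_one]
  rw [Finset.card_range]
  refine Finset.sum_congr rfl fun A _ => ?_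
  have := two_mul_pairCover_le A (2 * m)
  rw [if_pos (by omega), Finset.prod_const]

lemma coverGen_eq : ∀ m j : ℕ, coverGen (2 * m + j) m =
    ∑ i ∈ Finset.range (m + 1), ((j + i - 1).choose i : ℕ[X]) * (X ^ i * (1 + X) ^ (2 * m - i))
  | 0, j => by simp [coverGen_zero_right]
  | m + 1, 0 => by
    rw [add_zero, coverGen_two_mul, Finset.sum_range_succ']
    simp
  | m + 1, j + 1 => by
    have h : 2 * (m + 1) + (j + 1) = 2 * m + (j + 1) + 2 := by ring
    have h' : 2 * m + (j + 1) + 1 = 2 * (m + 1) + j := by ring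
    rw [h, coverGen_add_two, h', coverGen_eq (m + 1) j, coverGen_eq m (j + 1),
      Finset.sum_range_succ', Finset.sum_range_succ' _ (m + 1), Finset.mul_sum, add_right_comm,
      ← Finset.sum_add_distrib]
    congr 1
    · refine Finset.sum_congr rfl fun i hi => ?_
      have hi : i < m + 1 := Finset.mem_range.1 hi
      have e1 : 2 * (m + 1) - (i + 1) = 2 * m - i + 1 := by omega
      have e2 : j + 1 + (i + 1) - 1 = j + i + 1 := by omega
      have e3 : j + (i + 1) - 1 = j + i := by omega
      have e4 : j + 1 + i - 1 = j + i := by omega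
      rw [e1, e2, e3, e4, Nat.choose_succ_succ']
      push_cast
      ring
    · simp

lemma card_filter_pairCover (m j s : ℕ) :
    ((Finset.range (2 * m + j)).powerset.filter fun A =>
      pairCover A (2 * m + j) ≤ m ∧ A.card = s).card =
    ∑ i ∈ Finset.range (m + 1),
      (if i ≤ s then (2 * m - i).choose (s - i) else 0) * (j + i - 1).choose i := by
  have h := congrArg (fun P => P.coeff s) (coverGen_eq m j)
  simp only [coverGen, finsetSum_coeff] at h
  rw [Finset.card_filter]
  refine Eq.trans (Finset.sum_congr rfl fun A _ => ?_)
    (h.trans (Finset.sum_congr rfl fun i _ => ?_))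
  · by_cases h1 : pairCover A (2 * m + j) ≤ m
    · simp [h1, coeff_X_pow, eq_comm]
    · simp [h1]
  · rw [← C_eq_natCast, coeff_C_mul, coeff_X_pow_mul', mul_comm]
    simp [coeff_one_add_X_pow]

lemma isFacial_homog_momentCurve_iff {α : Type*} {D : ℕ} (T : α → ℝ) (S : Finset α) :
    IsFacial (homog fun s => momentCurve D (T s)) S ↔
      ∃ p : ℝ[X], p.natDegree ≤ D ∧ (∀ s, 0 ≤ p.eval (T s)) ∧ ∀ s, p.eval (T s) = 0 ↔ s ∈ S := by
  constructor
  · rintro ⟨c, hc0, hc⟩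
    have hp : ∀ t : ℝ, (∑ r : Fin (D + 1), C (c r) * X ^ (r : ℕ)).eval t =
        ∑ r : Fin (D + 1), t ^ (r : ℕ) * c r := fun t => by
      rw [eval_finsetSum]
      exact Finset.sum_congr rfl fun r _ => by rw [eval_mul, eval_C, eval_pow, eval_X, mul_comm]
    refine ⟨∑ r : Fin (D + 1), C (c r) * X ^ (r : ℕ), ?_, fun s => ?_, fun s => ?_⟩
    · refine natDegree_sum_le_of_forall_le _ _ fun r _ => ?_
      exact (natDegree_C_mul_X_pow_le _ _).trans (Nat.le_of_lt_succ r.is_lt)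
    · have := hc0 s
      rw [homog_momentCurve] at this
      rwa [hp]
    · rw [hp, ← hc, homog_momentCurve]
      rfl
  · rintro ⟨p, hpD, hp0, hp⟩
    have h : ∀ s, homog (fun s => momentCurve D (T s)) s ⬝ᵥ (fun r => p.coeff r) = p.eval (T s) :=
      fun s => by
        rw [homog_momentCurve, eval_eq_sum_range' (Nat.lt_succ_of_le hpD),
          ← Fin.sum_univ_eq_sum_range (fun r => p.coeff r * T s ^ r)]
        exact Finset.sum_congr rfl fun r _ => mul_comm _ _
    exact ⟨fun r => p.coeff r, fun s => by rw [h]; exact hp0 s, fun s => by rw [h, hp]⟩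

/-- The number of facial sets, of given size, of a cyclic configuration that are contained in an
initial or final segment of `n` of its points. -/
lemma ncard_isFacial_segment {α : Type*} {T : α → ℝ} {u : α → ℕ} {a b : ℝ}
    (hb : b ≠ 0) (hT : ∀ s, T s = a + b * (u s + 1)) (hu : Function.Injective u)
    {m j : ℕ} (hun : ∀ i < 2 * m + j, ∃ s, u s = i) (hlast : ∃ s, 2 * m + j ≤ u s) (k : ℕ) :
    {S : Finset α | (∀ s ∈ S, u s < 2 * m + j) ∧
      IsFacial (homog fun s => momentCurve (2 * m) (T s)) S ∧ S.card = k}.ncard =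
    ∑ i ∈ Finset.range (m + 1),
      (if i ≤ k then (2 * m - i).choose (k - i) else 0) * (j + i - 1).choose i := by
  classical
  rw [← card_filter_pairCover, ← Set.ncard_coe_finset]
  set n := 2 * m + j
  have hmem : ∀ (S : Finset α) s, u s ∈ S.image u ↔ s ∈ S := fun S s =>
    hu.mem_finset_image
  have hfac : ∀ S : Finset α, (∀ s ∈ S, u s < n) →
      (IsFacial (homog fun s => momentCurve (2 * m) (T s)) S ↔ pairCover (S.image u) n ≤ m) := by
    intro S hS
    rw [isFacial_homog_momentCurve_iff]
    constructor
    · rintro ⟨p, hpd, hp0, hp⟩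
      obtain ⟨s₀, hs₀⟩ := hlast
      have hs₀' : (n : ℝ) < u s₀ + 1 := by
        have : (n : ℝ) ≤ u s₀ := by exact_mod_cast hs₀
        linarith
      have hev : ∀ s, (p.comp (C a + C b * X)).eval ((u s : ℝ) + 1) = p.eval (T s) := fun s => by
        rw [eval_comp, hT]
        simp only [eval_add, eval_mul, eval_C, eval_X]
      have hdeg : (p.comp (C a + C b * X)).natDegree ≤ 2 * m := by
        refine natDegree_comp_le.trans ?_
        have : (C a + C b * X : ℝ[X]).natDegree ≤ 1 := by compute_degree
        nlinarith
      have := two_mul_pairCover_le_natDegree (S.image u) n (p.comp (C a + C b * X)) _ hs₀'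
        (by
          rw [hev]
          refine lt_of_le_of_ne (hp0 s₀) fun h => ?_
          exact absurd (hS s₀ ((hp s₀).1 h.symm)) (by omega))
        (fun i hi => by
          obtain ⟨s, rfl⟩ := hun i hi
          rw [hev]; exact hp0 s)
        (fun i hi => by
          obtain ⟨s, rfl⟩ := hun i hi
          rw [hev, hp, hmem])
      omega
    · intro h
      obtain ⟨p, hpd, hp0, hp⟩ := exists_polynomial_pairCover (S.image u) n
      have hev : ∀ s, (p.comp (C (-(a / b)) + C b⁻¹ * X)).eval (T s) = p.eval ((u s : ℝ) + 1) :=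
        fun s => by
          rw [eval_comp]
          congr 1
          simp only [eval_add, eval_mul, eval_C, eval_X, hT]
          field_simp
          ring
      refine ⟨p.comp (C (-(a / b)) + C b⁻¹ * X), ?_, fun s => ?_, fun s => ?_⟩
      · refine natDegree_comp_le.trans ?_
        have : (C (-(a / b)) + C b⁻¹ * X : ℝ[X]).natDegree ≤ 1 := by compute_degree
        nlinarith
      · rw [hev]; exact hp0 _
      · rw [hev, hp, hmem]
        exact ⟨fun h => h.2, fun h => ⟨hS s h, h⟩⟩
  refine Set.ncard_congr (fun S _ => S.image u) ?_ ?_ ?_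
  · rintro S ⟨hS, hf, hk⟩
    simp only [Finset.coe_filter, Finset.mem_powerset, Set.mem_ofPred_eq]
    refine ⟨fun i hi => ?_, (hfac S hS).1 hf, by rw [Finset.card_image_of_injective _ hu, hk]⟩
    obtain ⟨s, hs, rfl⟩ := Finset.mem_image.1 hi
    exact Finset.mem_range.2 (hS s hs)
  · intro S S' _ _ h
    exact Finset.image_injective hu h
  · intro A hA
    simp only [Finset.coe_filter, Finset.mem_powerset, Set.mem_ofPred_eq] at hA
    obtain ⟨hA, hp, hk⟩ := hA
    have himg : (A.preimage u hu.injOn).image u = A := by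
      rw [Finset.image_preimage, Finset.filter_true_of_mem]
      exact fun i hi => hun i (Finset.mem_range.1 (hA hi))
    have hlt : ∀ s ∈ A.preimage u hu.injOn, u s < n := fun s hs =>
      Finset.mem_range.1 (hA (Finset.mem_preimage.1 hs))
    refine ⟨A.preimage u hu.injOn, ⟨hlt, (hfac _ hlt).2 (by rwa [himg]), ?_⟩, himg⟩
    rw [← Finset.card_image_of_injective _ hu, himg, hk]

end EvennessCount

section Neighborly

open Matrix Polynomial

variable {α : Type*} {d : ℕ} {p : α → Euc d}

lemma setDim_convexHull_range_of_det [Fintype α] (hcard : d + 1 ≤ Fintype.card α)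
    (hdet : ∀ f : Fin (d + 1) → α, Function.Injective f →
      (Matrix.of fun r => homog p (f r)).det ≠ 0) :
    setDim (convexHull ℝ (Set.range p)) = d := by
  classical
  obtain ⟨f, hf, -⟩ := exists_injective_range_between (m := d + 1)
    (Finset.subset_univ (∅ : Finset α)) (by simp) (by simpa using hcard)
  have h := setDim_convexHull_image_of_det p (Finset.univ.image f) (by simp) f (hdet f hf)
    (by simp)
  rw [Finset.card_image_of_injective _ hf, Finset.card_univ, Fintype.card_fin,
    setDim_convexHull] at h
  rw [setDim_convexHull]
  refine le_antisymm ((Submodule.finrank_le _).trans (by simp)) ?_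
  have := Submodule.finrank_mono (vectorSpan_mono ℝ
    (Set.image_subset_range p ((Finset.univ.image f : Finset α) : Set α)))
  omega

lemma mem_vertSet_of_isFacial {i : α} (h : IsFacial (homog p) {i}) :
    p i ∈ vertSet (convexHull ℝ (Set.range p)) := by
  have h1 := (h.convexHull_image (Finset.singleton_nonempty i)).1
  rw [Finset.coe_singleton, Set.image_singleton, convexHull_singleton] at h1
  exact isExtreme_singleton.1 h1.isExtreme

lemma injective_of_isFacial (h : ∀ i, IsFacial (homog p) {i}) : Function.Injective p :=
  fun i j hij => by
    have := ((h j).convexHull_image (Finset.singleton_nonempty j)).2 i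
    rw [hij, ((h j).convexHull_image (Finset.singleton_nonempty j)).2 j] at this
    simpa using this

lemma vertSet_convexHull_range (h : ∀ i, IsFacial (homog p) {i}) :
    vertSet (convexHull ℝ (Set.range p)) = Set.range p :=
  Set.Subset.antisymm extremePoints_convexHull_subset
    (Set.range_subset_iff.2 fun i => mem_vertSet_of_isFacial (h i))

lemma vertCount_convexHull_range [Fintype α] (h : ∀ i, IsFacial (homog p) {i}) :
    vertCount (convexHull ℝ (Set.range p)) = Fintype.card α := by
  rw [vertCount, vertSet_convexHull_range h, ← Set.image_univ,
    Set.ncard_image_of_injective _ (injective_of_isFacial h), Set.ncard_univ,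
    Nat.card_eq_fintype_card]

lemma polytopeNeighborly_convexHull_range [Fintype α] {k : ℕ}
    (hk : k < Fintype.card α) (h1 : ∀ i, IsFacial (homog p) {i})
    (h : ∀ S : Finset α, S.card ≤ k → IsFacial (homog p) S) :
    PolytopeNeighborly (convexHull ℝ (Set.range p)) k := by
  classical
  rw [PolytopeNeighborly, vertSet_convexHull_range h1]
  intro S hS hne hSk
  obtain ⟨A, rfl⟩ : ∃ A : Finset α, S = p '' A :=
    ⟨Finset.univ.filter fun i => p i ∈ S, by
      ext x
      constructor
      · intro hx
        obtain ⟨i, rfl⟩ := hS hx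
        exact ⟨i, by simpa using hx, rfl⟩
      · rintro ⟨i, hi, rfl⟩
        simpa using hi⟩
  have hA : A.card ≤ k := by
    rwa [Set.ncard_image_of_injective _ (injective_of_isFacial h1), Set.ncard_coe_finset] at hSk
  obtain ⟨he, hm⟩ := (h A hA).convexHull_image (by simpa using hne)
  refine ⟨convexHull ℝ (p '' A), ⟨he, fun hP => ?_, hne.convexHull⟩,
    Set.Subset.antisymm extremePoints_convexHull_subset ?_⟩
  · have : A = Finset.univ := Finset.eq_univ_of_forall fun i =>
      (hm i).1 (hP ▸ subset_convexHull ℝ _ ⟨i, rfl⟩)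
    rw [this, Finset.card_univ] at hA
    omega
  · rintro _ ⟨i, hi, rfl⟩
    exact inter_extremePoints_subset_extremePoints_of_subset he.subset
      ⟨(hm i).2 hi, mem_vertSet_of_isFacial (h1 i)⟩

lemma homog_comp_dotProduct (σ : Equiv.Perm (Fin d)) (s : α) (c : Fin (d + 1) → ℝ) :
    homog (fun s => p s ∘ σ) s ⬝ᵥ c =
      homog p s ⬝ᵥ (Fin.cons (c 0) fun r => c (σ.symm r).succ) := by
  simp only [homog_dotProduct, Fin.cons_zero, Fin.cons_succ, Function.comp_apply]
  congr 1
  exact Fintype.sum_equiv σ _ _ fun r => by simp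

lemma isFacial_homog_momentCurve_comp {T : α → ℝ} (hT : Function.Injective T)
    (σ : Equiv.Perm (Fin d)) {S : Finset α} (hS : 2 * S.card ≤ d) :
    IsFacial (homog fun s => momentCurve d (T s) ∘ σ) S := by
  obtain ⟨c, hc0, hc⟩ := (isFacial_homog_momentCurve_iff (D := d) T S).2
    ⟨(∏ s ∈ S, (X - C (T s))) ^ 2, by
      rw [natDegree_pow, natDegree_prod_of_monic _ _ fun s _ => monic_X_sub_C _]
      simpa using hS, fun s => by rw [eval_pow]; exact sq_nonneg _, fun s => by
      rw [eval_pow, pow_eq_zero_iff two_ne_zero, eval_prod, Finset.prod_eq_zero_iff]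
      simp only [eval_sub, eval_X, eval_C, sub_eq_zero, hT.eq_iff, exists_eq_right']⟩
  have h : ∀ s, homog (fun s => momentCurve d (T s) ∘ σ) s ⬝ᵥ
      (Fin.cons (c 0) fun r => c (σ r).succ) = homog (fun s => momentCurve d (T s)) s ⬝ᵥ c :=
    fun s => by
      rw [homog_comp_dotProduct]
      congr 1
      ext r
      refine Fin.cases ?_ (fun r => ?_) r <;> simp
  exact ⟨_, fun s => by rw [h]; exact hc0 s, fun s => by rw [h, hc]⟩

lemma det_homog_momentCurve_ne_zero {T : α → ℝ} (hT : Function.Injective T)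
    {f : Fin (d + 1) → α} (hf : Function.Injective f) :
    (Matrix.of fun r => homog (fun s => momentCurve d (T s)) (f r)).det ≠ 0 := by
  rw [of_homog_momentCurve]
  exact Matrix.det_vandermonde_ne_zero_iff.2 (hT.comp hf)

lemma det_homog_momentCurve_comp_ne_zero {T : α → ℝ} (hT : Function.Injective T)
    (σ : Equiv.Perm (Fin d)) {f : Fin (d + 1) → α} (hf : Function.Injective f) :
    (Matrix.of fun r => homog (fun s => momentCurve d (T s) ∘ σ) (f r)).det ≠ 0 := by
  intro h0
  obtain ⟨c, hc, hMc⟩ := Matrix.exists_mulVec_eq_zero_iff.2 h0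
  have h := eq_zero_of_dotProduct_eq_zero _ f (det_homog_momentCurve_ne_zero hT hf)
    (Fin.cons (c 0) fun r => c (σ.symm r).succ) fun r => by
      rw [← homog_comp_dotProduct]
      exact congrFun hMc r
  refine hc (funext fun r => Fin.cases ?_ (fun r => ?_) r)
  · simpa using congrFun h 0
  · simpa using congrFun h (σ r).succ

/-- Polytopes spanned by points on a moment curve with permuted coordinates are neighborly. -/
lemma momentCurve_comp_polytope [Fintype α] {T : α → ℝ} (hT : Function.Injective T)
    (σ : Equiv.Perm (Fin d)) (hd : 2 ≤ d) (hcard : d + 1 ≤ Fintype.card α) :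
    IsPolytope (convexHull ℝ (Set.range fun s => momentCurve d (T s) ∘ σ)) ∧
    setDim (convexHull ℝ (Set.range fun s => momentCurve d (T s) ∘ σ)) = d ∧
    vertCount (convexHull ℝ (Set.range fun s => momentCurve d (T s) ∘ σ)) = Fintype.card α ∧
    PolytopeNeighborly (convexHull ℝ (Set.range fun s => momentCurve d (T s) ∘ σ)) (d / 2) := by
  have h1 : ∀ i, IsFacial (homog fun s => momentCurve d (T s) ∘ σ) {i} := fun i =>
    isFacial_homog_momentCurve_comp hT σ (by simpa using hd)
  exact ⟨⟨_, Set.finite_range _, rfl⟩,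
    setDim_convexHull_range_of_det hcard fun f hf => det_homog_momentCurve_comp_ne_zero hT σ hf,
    vertCount_convexHull_range h1,
    polytopeNeighborly_convexHull_range (by omega) h1 fun S hS =>
      isFacial_homog_momentCurve_comp hT σ (by omega)⟩

end Neighborly

section Assembly

open Matrix

lemma ncard_isFacial_segment_eq_sum_ubTerm {α : Type*} {T : α → ℝ} {u : α → ℕ} {a b : ℝ}
    (hb : b ≠ 0) (hT : ∀ s, T s = a + b * (u s + 1)) (hu : Function.Injective u) {d n : ℕ}
    (hd : Odd d) (hn : d + 1 ≤ n) (hun : ∀ i < n, ∃ s, u s = i) (hlast : ∃ s, n ≤ u s) (k : ℕ) :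
    {S : Finset α | (∀ s ∈ S, u s < n) ∧
      IsFacial (homog fun s => momentCurve (d + 1) (T s)) S ∧ S.card = k}.ncard =
    ∑ i ∈ Finset.range ((d + 1) / 2 + 1),
      (if i ≤ k then (d + 1 - i).choose (k - i) else 0) * ubTerm n d i := by
  obtain ⟨m, hm⟩ : ∃ m, 2 * m = d + 1 := by
    obtain ⟨q, rfl⟩ := hd
    exact ⟨q + 1, by ring⟩
  have hmn : d + 1 + (n - (d + 1)) = n := by omega
  have h := ncard_isFacial_segment hb hT hu (m := m) (j := n - (d + 1))
    (by rwa [hm, hmn]) (by rwa [hm, hmn]) k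
  rw [hm, hmn] at h
  rw [h, show (d + 1) / 2 = m by omega]
  refine Finset.sum_congr rfl fun i _ => ?_
  rw [ubTerm, show n - (d + 1) + i - 1 = n + i - (d + 2) by omega]

/-- The parameters of the vertices of a cyclic polytope, split into an initial segment and the
remaining final segment. -/
def splitParam (n₁ n₂ : ℕ) (s : Fin n₁ ⊕ Fin n₂) : ℝ := ((finSumFinEquiv s : ℕ) : ℝ) + 1

lemma splitParam_injective (n₁ n₂ : ℕ) : Function.Injective (splitParam n₁ n₂) := fun s t h => by
  simpa [splitParam, Fin.val_inj] using h

lemma cyclicPolytope_eq_range (D n₁ n₂ : ℕ) :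
    cyclicPolytope D (n₁ + n₂) =
      convexHull ℝ (Set.range fun s => momentCurve D (splitParam n₁ n₂ s)) := by
  rw [cyclicPolytope, ← Set.range_comp,
    ← EquivLike.range_comp _ (finSumFinEquiv (m := n₁) (n := n₂))]
  rfl

/-- Faces of a cyclic polytope, split according to whether they meet both segments. -/
lemma faceCount_cyclicPolytope_split {d n₁ n₂ : ℕ} (hd : Odd d) (hn₁ : d + 1 ≤ n₁)
    (hn₂ : d + 1 ≤ n₂) {k : ℕ} (hkd : k ≤ d) :
    faceCount (cyclicPolytope (d + 1) (n₁ + n₂)) k =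
      {S : Finset (Fin n₁ ⊕ Fin n₂) | S.toLeft.Nonempty ∧ S.toRight.Nonempty ∧
        IsFacial (homog fun s => momentCurve (d + 1) (splitParam n₁ n₂ s)) S ∧
        S.card = k + 1}.ncard +
      ∑ i ∈ Finset.range ((d + 1) / 2 + 1),
        (if i ≤ k + 1 then (d + 1 - i).choose (k + 1 - i) else 0) *
          (ubTerm n₁ d i + ubTerm n₂ d i) := by
  rw [cyclicPolytope_eq_range, faceCount_convexHull_range_of_det _
    (by rw [Fintype.card_sum, Fintype.card_fin, Fintype.card_fin]; omega)
    (fun f hf => det_homog_momentCurve_ne_zero (splitParam_injective n₁ n₂) hf) (by omega)]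
  simp only [mul_add, Finset.sum_add_distrib]
  have hl := ncard_isFacial_segment_eq_sum_ubTerm (T := splitParam n₁ n₂)
    (u := fun s => (finSumFinEquiv s : ℕ)) (a := 0) one_ne_zero
    (fun s => by rw [splitParam]; ring)
    (Fin.val_injective.comp finSumFinEquiv.injective) hd hn₁
    (fun i hi => ⟨Sum.inl ⟨i, hi⟩, by simp⟩) ⟨Sum.inr ⟨0, by omega⟩, by simp⟩ (k + 1)
  have hr := ncard_isFacial_segment_eq_sum_ubTerm (T := splitParam n₁ n₂)
    (u := fun s => ((finSumFinEquiv s).rev : ℕ)) (a := n₁ + n₂ + 1) (neg_ne_zero.2 one_ne_zero)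
    (fun s => by
      have h : ((finSumFinEquiv s).rev : ℕ) + ((finSumFinEquiv s : ℕ) + 1) = n₁ + n₂ := by
        have := (finSumFinEquiv s).is_lt
        rw [Fin.val_rev]; omega
      have h' : (((finSumFinEquiv s).rev : ℕ) : ℝ) + (((finSumFinEquiv s : ℕ) : ℝ) + 1) =
          n₁ + n₂ := by exact_mod_cast h
      rw [splitParam]; linarith)
    (Fin.val_injective.comp (Fin.rev_injective.comp finSumFinEquiv.injective)) hd hn₂
    (fun i hi => ⟨Sum.inr (Fin.rev ⟨i, hi⟩), by simp [Fin.val_rev]; omega⟩)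
    ⟨Sum.inl ⟨0, by omega⟩, by simp [Fin.val_rev]; omega⟩ (k + 1)
  have hL (S : Finset (Fin n₁ ⊕ Fin n₂)) :
      (∀ s ∈ S, (finSumFinEquiv s : ℕ) < n₁) ↔ S.toRight = ∅ := by
    rw [Finset.eq_empty_iff_forall_notMem]
    constructor
    · intro h j hj
      have := h _ (Finset.mem_toRight.1 hj)
      simp at this
    · rintro h (i | j) hs
      · simp
      · exact absurd (Finset.mem_toRight.2 hs) (h j)
  have hR (S : Finset (Fin n₁ ⊕ Fin n₂)) :
      (∀ s ∈ S, ((finSumFinEquiv s).rev : ℕ) < n₂) ↔ S.toLeft = ∅ := by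
    rw [Finset.eq_empty_iff_forall_notMem]
    constructor
    · intro h i hi
      have := h _ (Finset.mem_toLeft.1 hi)
      have := i.is_lt
      simp [Fin.val_rev] at *
      omega
    · rintro h (i | j) hs
      · exact absurd (Finset.mem_toLeft.2 hs) (h i)
      · have := j.is_lt
        simp [Fin.val_rev]
        omega
  rw [← hl, ← hr, ← Set.ncard_union_eq ?_ (Set.toFinite _) (Set.toFinite _),
    ← Set.ncard_union_eq ?_ (Set.toFinite _) (Set.toFinite _)]
  · congr 1
    ext S
    simp only [Set.mem_union, Set.mem_ofPred_eq, hL, hR, Finset.nonempty_iff_ne_empty]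
    tauto
  · refine Set.disjoint_left.2 fun S hS hS' => ?_
    simp only [Set.mem_union, Set.mem_ofPred_eq, hL, hR, Finset.nonempty_iff_ne_empty] at hS hS'
    tauto
  · refine Set.disjoint_left.2 fun S hS hS' => ?_
    simp only [Set.mem_ofPred_eq, hL, hR] at hS hS'
    have := S.card_toLeft_add_card_toRight
    rw [hS.1, hS'.1, hS.2.2] at this
    simp at this

end Assembly

/-- for odd `d ≥ 3`, there exist two `⌊d/2⌋`-neighborly `d`-polytopes with
`n1` and `n2` vertices whose Minkowski sum attains the upper bound for all face numbers. -/
theorem statement_5 (d n1 n2 : ℕ) (hd : 3 ≤ d) (hdodd : Odd d)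
    (hn1 : d + 1 ≤ n1) (hn2 : d + 1 ≤ n2) :
    ∃ P1 P2 : Set (Euc d),
      IsPolytope P1 ∧ IsPolytope P2 ∧ setDim P1 = d ∧ setDim P2 = d ∧
        vertCount P1 = n1 ∧ vertCount P2 = n2 ∧
        PolytopeNeighborly P1 (d / 2) ∧ PolytopeNeighborly P2 (d / 2) ∧
        ∀ k : ℕ, 1 ≤ k → k ≤ d →
          (faceCount (P1 + P2) (k - 1) : ℤ) = minkBound d n1 n2 k := by
  let x : Fin n1 → ℝ := fun i => (i : ℝ) + 1
  let y : Fin n2 → ℝ := fun j => (n2 : ℝ) - j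
  have hxi : Function.Injective x := fun i i' h => by simpa [x, Fin.val_inj] using h
  have hyi : Function.Injective y := fun j j' h => by simpa [y, Fin.val_inj] using h
  have hy : ∀ j, 0 < y j := fun j => sub_pos.2 (by exact_mod_cast j.is_lt)
  obtain ⟨τ, hτ, hsign⟩ := exists_sign_det_cayConf_eq (d := d) (x := x) hy hxi hyi
    (T := splitParam n1 n2) (fun i i' => by simp [splitParam, x])
    (fun j j' => by simp [splitParam, y])
    (fun i j => by
      have : ((i : ℕ) : ℝ) < n1 := by exact_mod_cast i.is_lt
      simp [splitParam]
      have : (0 : ℝ) ≤ (j : ℕ) := Nat.cast_nonneg _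
      linarith)
  have hdet : ∀ f : Fin (d + 2) → Fin n1 ⊕ Fin n2, Function.Injective f → _ :=
    fun f hf => det_homog_momentCurve_ne_zero (d := d + 1) (splitParam_injective n1 n2) hf
  have hτx : Function.Injective fun i => τ * x i := (mul_right_injective₀ hτ.ne').comp hxi
  have hτy : Function.Injective fun j => τ * y j := (mul_right_injective₀ hτ.ne').comp hyi
  have hd2 : 2 ≤ d := by omega
  obtain ⟨p1, p2, p3, p4⟩ := momentCurve_comp_polytope hτx (Equiv.refl (Fin d)) hd2
    (by rwa [Fintype.card_fin])
  obtain ⟨q1, q2, q3, q4⟩ := momentCurve_comp_polytope hτy Fin.revPerm hd2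
    (by rwa [Fintype.card_fin])
  refine ⟨_, _, p1, q1, p2, q2, by simpa using p3, by simpa using q3, p4, q4,
    fun k hk1 hkd => ?_⟩
  have hcay : ∀ f : Fin (d + 2) → Fin n1 ⊕ Fin n2, Function.Injective f →
      (∃ r i, f r = Sum.inl i) → (∃ r j, f r = Sum.inr j) →
      (Matrix.of fun r => cayConf (fun i => momentCurve d (τ * x i))
        (fun j => momentCurve d (τ * y j) ∘ Fin.rev) (f r)).det ≠ 0 := fun f hf hl hr => by
    rw [← sign_ne_zero, hsign f hf hl hr, sign_ne_zero]
    exact hdet f hf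
  have hcount := faceCount_add_of_det (fun i => momentCurve d (τ * x i))
    (fun j => momentCurve d (τ * y j) ∘ Fin.rev) (by simp; omega) hcay hk1 hkd
  have hset : {S : Finset (Fin n1 ⊕ Fin n2) | S.toLeft.Nonempty ∧ S.toRight.Nonempty ∧
        IsFacial (cayConf (fun i => momentCurve d (τ * x i))
          (fun j => momentCurve d (τ * y j) ∘ Fin.rev)) S ∧ S.card = k + 1} =
      {S : Finset (Fin n1 ⊕ Fin n2) | S.toLeft.Nonempty ∧ S.toRight.Nonempty ∧
        IsFacial (homog fun s => momentCurve (d + 1) (splitParam n1 n2 s)) S ∧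
        S.card = k + 1} := by
    ext S
    refine and_congr_right fun hL => and_congr_right fun hR => and_congr_left fun _ => ?_
    obtain ⟨i₀, hi₀⟩ := hL
    obtain ⟨j₀, hj₀⟩ := hR
    have hS₀ : ({Sum.inl i₀, Sum.inr j₀} : Finset (Fin n1 ⊕ Fin n2)) ⊆ S := by
      simp [Finset.insert_subset_iff, Finset.mem_toLeft.1 hi₀, Finset.mem_toRight.1 hj₀]
    have hc : ({Sum.inl i₀, Sum.inr j₀} : Finset (Fin n1 ⊕ Fin n2)).card < d + 2 := by
      rw [Finset.card_pair (by simp)]; omega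
    have hcard : d + 2 ≤ Fintype.card (Fin n1 ⊕ Fin n2) := by simp; omega
    have hlr : ∀ f : Fin (d + 2) → Fin n1 ⊕ Fin n2,
        (∀ s ∈ ({Sum.inl i₀, Sum.inr j₀} : Finset (Fin n1 ⊕ Fin n2)), ∃ r, f r = s) →
        (∃ r i, f r = Sum.inl i) ∧ ∃ r j, f r = Sum.inr j := fun f hf => by
      obtain ⟨r, hr⟩ := hf (Sum.inl i₀) (by simp)
      obtain ⟨r', hr'⟩ := hf (Sum.inr j₀) (by simp)
      exact ⟨⟨r, i₀, hr⟩, r', j₀, hr'⟩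
    exact ⟨IsFacial.of_sign_det_eq hc hcard
        (fun f hf h => hcay f hf (hlr f h).1 (hlr f h).2)
        (fun f hf h => hsign f hf (hlr f h).1 (hlr f h).2) hS₀,
      IsFacial.of_sign_det_eq hc hcard (fun f hf _ => hdet f hf)
        (fun f hf h => (hsign f hf (hlr f h).1 (hlr f h).2).symm) hS₀⟩
  have hcyc := faceCount_cyclicPolytope_split hdodd hn1 hn2 hkd
  rw [← hset, ← hcount] at hcyc
  rw [minkBound, hcyc, eq_sub_iff_add_eq]
  push_cast
  rfl
end
end

section
/- Let C be a polytopal d-complex with vertex set V, let {V1, V2} be a partition of V into nonempty parts with |V1| = n1 and |V2| = n2, and let B be the set of faces of C that have at least one vertex in V1 and at least one vertex in V2. Then for every k with 1 ≤ k ≤ d, the number of (k−1)-faces in B satisfies f_{k−1}(B) ≤ Σ_{j=1}^{k−1} binom(n1, j)·binom(n2, k−j) = binom(n1+n2, k) − binom(n1, k) − binom(n2, k), and equality holds if and only if C is (V1;k)-bineighborly. -/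
open Set Pointwise

noncomputable section

section Polytopes

variable {d : ℕ} {F : Set (Euc d)}

theorem IsPolytope.vertSet_finite (hF : IsPolytope F) : (vertSet F).Finite := by
  obtain ⟨S, hS, rfl⟩ := hF
  exact hS.subset extremePoints_convexHull_subset

theorem IsPolytope.convexHull_vertSet (hF : IsPolytope F) :
    convexHull ℝ (vertSet F) = F := by
  have hfin := hF.vertSet_finite
  obtain ⟨S, hS, rfl⟩ := hF
  rw [← (hfin.isClosed_convexHull ℝ).closure_eq]
  exact closure_convexHull_extremePoints (hS.isCompact_convexHull ℝ) (convex_convexHull ℝ S)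

theorem IsPolytope.affineSpan_vertSet (hF : IsPolytope F) :
    affineSpan ℝ (vertSet F) = affineSpan ℝ F := by
  rw [← affineSpan_convexHull, hF.convexHull_vertSet]

/-- Vertices of a polytope are exposed. -/
theorem IsPolytope.isExposed_singleton (hF : IsPolytope F) {v : Euc d} (hv : v ∈ vertSet F) :
    IsExposed ℝ F {v} := by
  obtain ⟨S, hS, rfl⟩ := hF
  have hvS : v ∈ S := extremePoints_convexHull_subset hv
  have hconv := ((convex_convexHull ℝ S).mem_extremePoints_iff_convex_sdiff.1 hv).2
  have hsub : convexHull ℝ (S \ {v}) ⊆ convexHull ℝ S \ {v} :=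
    convexHull_min (sdiff_subset_sdiff_left (subset_convexHull ℝ S)) hconv
  have hnot : v ∉ convexHull ℝ (S \ {v}) := fun h => (hsub h).2 rfl
  obtain ⟨f, u, hfu, hfv⟩ := geometric_hahn_banach_closed_point (convex_convexHull ℝ (S \ {v}))
    ((hS.sdiff).isClosed_convexHull ℝ) hnot
  have hle : ∀ y ∈ convexHull ℝ S, f y ≤ f v := fun y hy => by
    refine convexHull_min (t := {y | f y ≤ f v}) (fun s hs => ?_)
      (convex_halfSpace_le f.toLinearMap.isLinear _) hy
    by_cases hsv : s = v
    · simp [hsv]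
    · exact ((hfu s (subset_convexHull ℝ _ ⟨hs, hsv⟩)).trans hfv).le
  refine fun _ => ⟨f, Subset.antisymm ?_ ?_⟩
  · rintro _ rfl
    exact ⟨subset_convexHull ℝ S hvS, hle⟩
  · rintro x ⟨hx, hmax⟩
    have hxv : f v ≤ f x := hmax v (subset_convexHull ℝ S hvS)
    have hins : insert v (S \ {v}) = S := by simp [insert_eq_of_mem hvS]
    rcases (S \ {v}).eq_empty_or_nonempty with he | hne
    · rw [← hins, he] at hx
      simpa using hx
    · rw [← hins, convexHull_insert hne, mem_convexJoin] at hx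
      obtain ⟨a, ha, b, hb, hx⟩ := hx
      obtain rfl : a = v := ha
      obtain ⟨p, q, hp, hq, hpq, rfl⟩ := hx
      have hb' := hfu b hb
      simp only [map_add, map_smul, smul_eq_mul] at hxv
      obtain rfl : p = 1 - q := by linarith
      have hq0 : q = 0 := by nlinarith
      simp [hq0]

end Polytopes

section Exposed

variable {d : ℕ}

/-- An exposed face containing points that affinely span the whole set is the whole set. -/
theorem IsExposed.eq_of_subset_affineSpan {A B T : Set (Euc d)} (h : IsExposed ℝ A B)
    (hTB : T ⊆ B) (hT : T.Nonempty) (hA : A ⊆ affineSpan ℝ T) : B = A := by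
  refine h.subset.antisymm fun x hx => ?_
  obtain ⟨t, ht⟩ := hT
  obtain ⟨l, rfl⟩ := h ⟨t, hTB ht⟩
  have heq : T.EqOn (l.toLinearMap.toAffineMap) (AffineMap.const ℝ (Euc d) (l t)) := fun s hs =>
    le_antisymm ((hTB ht).2 s (hTB hs).1) ((hTB hs).2 t (hTB ht).1)
  have hlx : l x = l t := AffineMap.eqOn_affineSpan heq (hA hx)
  exact ⟨hx, fun y hy => hlx ▸ (hTB ht).2 y hy⟩

end Exposed

section AffineIndependence

variable {d : ℕ}

theorem affineIndependent_insert_of_notMem {t : Set (Euc d)} {w : Euc d}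
    (ht : AffineIndependent ℝ ((↑) : t → Euc d)) (hw : w ∉ affineSpan ℝ t) :
    AffineIndependent ℝ ((↑) : ↥(insert w t : Set (Euc d)) → Euc d) := by
  have hwt : w ∉ t := fun h => hw (subset_affineSpan ℝ t h)
  refine AffineIndependent.affineIndependent_of_notMem_span
    (i := (⟨w, mem_insert w t⟩ : ↥(insert w t : Set (Euc d)))) ?_ ?_
  · have hmem : ∀ x : {y : ↥(insert w t : Set (Euc d)) // y ≠ ⟨w, mem_insert w t⟩},
        (x.1 : Euc d) ∈ t := fun x =>
      x.1.2.resolve_left fun h => x.2 (Subtype.ext h)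
    let e : {y : ↥(insert w t : Set (Euc d)) // y ≠ ⟨w, mem_insert w t⟩} ↪ t :=
      ⟨fun x => ⟨(x.1 : Euc d), hmem x⟩, fun x y hxy =>
        Subtype.ext (Subtype.ext (congrArg (fun z : t => (z : Euc d)) hxy))⟩
    exact ht.comp_embedding e
  · refine fun h => hw (affineSpan_mono ℝ ?_ h)
    rintro _ ⟨x, hx, rfl⟩
    exact x.2.resolve_left fun h => hx (Subtype.ext h)

theorem exists_affineIndependent_extension {s W : Set (Euc d)} (hW : W.Finite) (hsW : s ⊆ W)
    (hs : AffineIndependent ℝ ((↑) : s → Euc d)) :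
    ∃ t, s ⊆ t ∧ t ⊆ W ∧ AffineIndependent ℝ ((↑) : t → Euc d) ∧
      affineSpan ℝ t = affineSpan ℝ W := by
  have hfin : {t | t ⊆ W ∧ AffineIndependent ℝ ((↑) : t → Euc d)}.Finite :=
    hW.finite_subsets.subset fun t ht => ht.1
  obtain ⟨t, hst, ht⟩ := hfin.exists_le_maximal ⟨hsW, hs⟩
  refine ⟨t, hst, ht.1.1, ht.1.2, (affineSpan_mono ℝ ht.1.1).antisymm
    (affineSpan_le.2 fun w hw => ?_)⟩
  by_contra hwt
  have hle := ht.2 (y := insert w t)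
    ⟨insert_subset hw ht.1.1, affineIndependent_insert_of_notMem ht.1.2 hwt⟩ (subset_insert w t)
  exact hwt (subset_affineSpan ℝ t (hle (mem_insert w t)))

theorem affineIndependent_pair {a b : Euc d} (hab : a ≠ b) :
    AffineIndependent ℝ ((↑) : ↥({a, b} : Set (Euc d)) → Euc d) := by
  refine affineIndependent_insert_of_notMem (t := {b})
    (affineIndependent_of_subsingleton ℝ ((↑) : ↥({b} : Set (Euc d)) → Euc d)) ?_
  simpa using hab

theorem setDim_add_one_eq_ncard {F T : Set (Euc d)}
    (hT : AffineIndependent ℝ ((↑) : T → Euc d)) (hne : T.Nonempty)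
    (hspan : affineSpan ℝ T = affineSpan ℝ F) : setDim F + 1 = T.ncard := by
  have : Fintype T := (finite_set_of_fin_dim_affineIndependent ℝ hT).fintype
  have : Nonempty T := hne.to_subtype
  have h := hT.finrank_vectorSpan_add_one
  rw [Subtype.range_coe] at h
  rw [setDim, ← hspan, direction_affineSpan, h, ← Nat.card_eq_fintype_card, Nat.card_coe_set_eq]

/-- Every face of a simplex is exposed. -/
theorem isExposed_convexHull_of_affineIndependent {S T : Set (Euc d)}
    (hT : AffineIndependent ℝ ((↑) : T → Euc d)) (hST : S ⊆ T) :
    IsExposed ℝ (convexHull ℝ T) (convexHull ℝ S) := by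
  classical
  intro hne
  obtain ⟨s₀, hs₀⟩ := convexHull_nonempty_iff.1 hne
  have hTfin := finite_set_of_fin_dim_affineIndependent ℝ hT
  obtain ⟨l, hl⟩ : ∃ l : StrongDual ℝ (Euc d),
      (∀ s ∈ S, l s = l s₀) ∧ ∀ t ∈ T \ S, l t = l s₀ - 1 := by
    obtain ⟨U, hTU, hU, hUtop⟩ := exists_subset_affineIndependent_affineSpan_eq_top hT
    let b : AffineBasis U ℝ (Euc d) := ⟨(↑), hU, by rwa [Subtype.range_coe]⟩
    have : Fintype U := (finite_set_of_fin_dim_affineIndependent ℝ hU).fintype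
    let f : Euc d →ᵃ[ℝ] ℝ := ∑ i : U with i.1 ∈ S, b.coord i
    have hf : ∀ t ∈ T, f t = if t ∈ S then 1 else 0 := fun t ht => by
      have hb : ∀ i, b.coord i t = if i = ⟨t, hTU ht⟩ then 1 else 0 := fun i =>
        b.coord_apply i ⟨t, hTU ht⟩
      have : f t = ∑ i : U with i.1 ∈ S, b.coord i t :=
        map_sum (⟨⟨fun g : Euc d →ᵃ[ℝ] ℝ => g t, rfl⟩, fun _ _ => rfl⟩ :
          (Euc d →ᵃ[ℝ] ℝ) →+ ℝ) _ _
      rw [this]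
      simp [hb]
    have hlin : ∀ x y, f.linear x - f.linear y = f x - f y := fun x y => by
      rw [← map_sub, ← vsub_eq_sub, f.linearMap_vsub, vsub_eq_sub]
    refine ⟨LinearMap.toContinuousLinearMap f.linear, fun s hs => ?_, fun t ht => ?_⟩
    · have := hlin s s₀
      rw [hf s (hST hs), hf s₀ (hST hs₀), if_pos hs, if_pos hs₀] at this
      simpa [sub_eq_zero] using this
    · have := hlin t s₀
      rw [hf t ht.1, hf s₀ (hST hs₀), if_neg ht.2, if_pos hs₀] at this
      simp only [LinearMap.coe_toContinuousLinearMap']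
      linarith
  have hle : ∀ t ∈ T, l t ≤ l s₀ := fun t ht => by
    by_cases hs : t ∈ S
    · exact (hl.1 t hs).le
    · linarith [hl.2 t ⟨ht, hs⟩]
  have hmax : ∀ y ∈ convexHull ℝ T, l y ≤ l s₀ := fun y hy =>
    convexHull_min (t := {y | l y ≤ l s₀}) hle (convex_halfSpace_le l.toLinearMap.isLinear _) hy
  refine ⟨l, Subset.antisymm (fun x hx => ⟨convexHull_mono hST hx, ?_⟩) ?_⟩
  · have hx' : l x = l s₀ := convexHull_min (t := {y | l y = l s₀}) hl.1
      (convex_hyperplane l.toLinearMap.isLinear _) hx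
    rwa [hx']
  · rintro x ⟨hx, hx'⟩
    have hge := hx' s₀ (subset_convexHull ℝ T (hST hs₀))
    lift T to Finset (Euc d) using hTfin
    obtain ⟨w, hw0, hw1, rfl⟩ := Finset.mem_convexHull'.1 hx
    have hsum : ∑ y ∈ T, w y * (l s₀ - l y) ≤ 0 := by
      simp only [mul_sub, Finset.sum_sub_distrib, ← Finset.sum_mul, hw1]
      simp only [map_sum, map_smul, smul_eq_mul] at hge
      linarith
    have hnn : ∀ y ∈ T, 0 ≤ w y * (l s₀ - l y) := fun y hy =>
      mul_nonneg (hw0 y hy) (sub_nonneg.2 (hle y hy))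
    have hzero := (Finset.sum_eq_zero_iff_of_nonneg hnn).1
      (hsum.antisymm (Finset.sum_nonneg hnn))
    have hwS : ∀ y ∈ T, y ∉ S → w y = 0 := fun y hy hyS => by
      have := hzero y hy
      rw [hl.2 y ⟨hy, hyS⟩] at this
      simpa using this
    have hTS : ∀ y ∈ T, y ∉ T.filter (· ∈ S) → w y = 0 := fun y hy hyS =>
      hwS y hy fun h => hyS (Finset.mem_filter.2 ⟨hy, h⟩)
    have hmem : ∑ y ∈ T.filter (· ∈ S), w y • y ∈ convexHull ℝ S := by
      refine (convex_convexHull ℝ S).sum_mem (fun y hy => hw0 y (Finset.mem_filter.1 hy).1) ?_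
        fun y hy => subset_convexHull ℝ S (Finset.mem_filter.1 hy).2
      rw [← hw1]
      exact Finset.sum_subset (Finset.filter_subset _ _) hTS
    convert hmem using 1
    exact (Finset.sum_subset (Finset.filter_subset _ _)
      fun y hy hyS => by rw [hTS y hy hyS, zero_smul]).symm

theorem vertSet_convexHull_of_affineIndependent {T : Set (Euc d)}
    (hT : AffineIndependent ℝ ((↑) : T → Euc d)) : vertSet (convexHull ℝ T) = T := by
  refine Subset.antisymm extremePoints_convexHull_subset fun v hv => ?_
  have h := isExposed_convexHull_of_affineIndependent hT (singleton_subset_iff.2 hv)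
  rw [convexHull_singleton] at h
  exact isExtreme_singleton.1 h.isExtreme

end AffineIndependence

section MixedSubsets

/-- The `k`-element subsets of `A ∪ B` meeting both `A` and `B`. -/
def mixedSubsets {α : Type*} (A B : Set α) (k : ℕ) : Set (Set α) :=
  {T | T ⊆ A ∪ B ∧ T.ncard = k ∧ (T ∩ A).Nonempty ∧ (T ∩ B).Nonempty}

variable {α : Type*} {A B : Set α}

theorem mixedSubsets_finite (hA : A.Finite) (hB : B.Finite) (k : ℕ) :
    (mixedSubsets A B k).Finite :=
  (hA.union hB).finite_subsets.subset fun _ h => h.1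

theorem ncard_mixedSubsets (hA : A.Finite) (hB : B.Finite) (hAB : Disjoint A B) {k : ℕ}
    (hk : 1 ≤ k) :
    ((mixedSubsets A B k).ncard : ℤ)
      = ((A.ncard + B.ncard).choose k : ℤ) - (A.ncard.choose k : ℤ) - (B.ncard.choose k : ℤ) := by
  classical
  lift A to Finset α using hA
  lift B to Finset α using hB
  rw [Finset.disjoint_coe] at hAB
  have himage : mixedSubsets (A : Set α) B k = (fun T : Finset α => (T : Set α)) ''
      (((A ∪ B).powersetCard k \ (A.powersetCard k ∪ B.powersetCard k) : Finset (Finset α)) :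
        Set (Finset α)) := by
    ext T
    constructor
    · rintro ⟨hsub, hcard, ⟨a, haT, haA⟩, ⟨b, hbT, hbB⟩⟩
      lift T to Finset α using (A ∪ B).finite_toSet.subset (by simpa using hsub)
      refine ⟨T, ?_, rfl⟩
      rw [← Finset.coe_union, Finset.coe_subset] at hsub
      rw [ncard_coe_finset] at hcard
      simp only [Finset.mem_coe, Finset.mem_sdiff, Finset.mem_union, Finset.mem_powersetCard]
      refine ⟨⟨hsub, hcard⟩, ?_⟩
      rintro (h | h)
      · exact Finset.disjoint_left.1 hAB (h.1 hbT) hbB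
      · exact Finset.disjoint_left.1 hAB haA (h.1 haT)
    · rintro ⟨T, hT, rfl⟩
      simp only [Finset.mem_coe, Finset.mem_sdiff, Finset.mem_union, Finset.mem_powersetCard,
        not_or, not_and] at hT
      obtain ⟨⟨hsub, hcard⟩, hA, hB⟩ := hT
      refine ⟨fun x hx => by simpa using hsub hx, by rwa [ncard_coe_finset], ?_, ?_⟩
      · by_contra h
        refine hB (fun x hx => (Finset.mem_union.1 (hsub hx)).resolve_left fun hxA => ?_) hcard
        exact h ⟨x, hx, hxA⟩
      · by_contra h
        refine hA (fun x hx => (Finset.mem_union.1 (hsub hx)).resolve_right fun hxB => ?_) hcard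
        exact h ⟨x, hx, hxB⟩
  have hdisj : Disjoint (A.powersetCard k) (B.powersetCard k) := by
    refine Finset.disjoint_left.2 fun T hTA hTB => ?_
    rw [Finset.mem_powersetCard] at hTA hTB
    have hempty : T = ∅ :=
      Finset.subset_empty.1 (Finset.disjoint_iff_inter_eq_empty.1 hAB ▸
        Finset.subset_inter hTA.1 hTB.1)
    rw [hempty, Finset.card_empty] at hTA
    omega
  have hsub : A.powersetCard k ∪ B.powersetCard k ⊆ (A ∪ B).powersetCard k :=
    Finset.union_subset (Finset.powersetCard_mono Finset.subset_union_left)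
      (Finset.powersetCard_mono Finset.subset_union_right)
  have hcard := Finset.card_sdiff_add_card_eq_card hsub
  rw [Finset.card_union_of_disjoint hdisj] at hcard
  simp only [Finset.card_powersetCard, Finset.card_union_of_disjoint hAB] at hcard
  rw [himage, ncard_image_of_injective _ Finset.coe_injective]
  simp only [ncard_coe_finset]
  rw [← hcard]
  push_cast
  ring

theorem sum_Ico_choose_mul_choose (m n : ℕ) {k : ℕ} (hk : 1 ≤ k) :
    ∑ j ∈ Finset.Ico 1 k, (m.choose j : ℤ) * (n.choose (k - j) : ℤ)
      = ((m + n).choose k : ℤ) - (m.choose k : ℤ) - (n.choose k : ℤ) := by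
  rw [Nat.add_choose_eq, Finset.Nat.sum_antidiagonal_eq_sum_range_succ_mk,
    Finset.sum_range_succ, Finset.range_eq_Ico,
    Finset.sum_eq_sum_Ico_succ_bot (show 0 < k by omega)]
  push_cast
  simp

end MixedSubsets

namespace PolyComplex

variable {N : ℕ} (C : PolyComplex N)

theorem verts_finite : C.verts.Finite :=
  C.finite_faces.preimage singleton_injective.injOn

variable {C}

theorem vertSet_subset_verts {F : Set (Euc N)} (hF : F ∈ C.faces) : vertSet F ⊆ C.verts :=
  fun _ hv => C.down_closed F hF _ ((C.polytope_mem F hF).isExposed_singleton hv)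

/-- Two faces sharing points that affinely span both of them are equal. -/
theorem eq_of_affineSpan_eq {F G T : Set (Euc N)} (hF : F ∈ C.faces) (hG : G ∈ C.faces)
    (hT : T.Nonempty) (hTF : T ⊆ F) (hTG : T ⊆ G) (hsF : affineSpan ℝ T = affineSpan ℝ F)
    (hsG : affineSpan ℝ T = affineSpan ℝ G) : F = G := by
  obtain ⟨h₁, h₂⟩ := C.inter_face F hF G hG
  have hsub : T ⊆ F ∩ G := subset_inter hTF hTG
  rw [← h₁.eq_of_subset_affineSpan hsub hT (hsF ▸ subset_affineSpan ℝ F)]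
  exact h₂.eq_of_subset_affineSpan hsub hT (hsG ▸ subset_affineSpan ℝ G)

/-- `T` is a set of vertices of `F` forming an affine basis of the affine hull of `F`. -/
def IsVertexBasis (F T : Set (Euc N)) : Prop :=
  T ⊆ vertSet F ∧ AffineIndependent ℝ ((↑) : T → Euc N) ∧ affineSpan ℝ T = affineSpan ℝ F

theorem IsVertexBasis.eq_of_common {F G T : Set (Euc N)} (hF : F ∈ C.faces) (hG : G ∈ C.faces)
    (hT : T.Nonempty) (hTF : IsVertexBasis F T) (hTG : IsVertexBasis G T) : F = G :=
  eq_of_affineSpan_eq hF hG hT (hTF.1.trans extremePoints_subset)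
    (hTG.1.trans extremePoints_subset) hTF.2.2 hTG.2.2

theorem exists_isVertexBasis {F s : Set (Euc N)} (hF : F ∈ C.faces) (hs : s ⊆ vertSet F)
    (hind : AffineIndependent ℝ ((↑) : s → Euc N)) : ∃ T, s ⊆ T ∧ IsVertexBasis F T := by
  have hP := C.polytope_mem F hF
  obtain ⟨T, hsT, hTF, hT, hspan⟩ := exists_affineIndependent_extension hP.vertSet_finite hs hind
  exact ⟨T, hsT, hTF, hT, hspan.trans hP.affineSpan_vertSet⟩

theorem lt_ncard_verts {F : Set (Euc N)} (hF : F ∈ C.faces) (hpos : 0 < setDim F) :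
    setDim F < C.verts.ncard := by
  obtain ⟨T, -, hTF, hT, hspan⟩ := exists_isVertexBasis hF (empty_subset _)
    (affineIndependent_of_subsingleton ℝ ((↑) : ↥(∅ : Set (Euc N)) → Euc N))
  have hne : T.Nonempty := by
    rw [nonempty_iff_ne_empty]
    rintro rfl
    rw [setDim, ← hspan, direction_affineSpan, vectorSpan_empty, finrank_bot] at hpos
    exact hpos.false
  have hcard := setDim_add_one_eq_ncard hT hne hspan
  have hle := ncard_le_ncard (hTF.trans (vertSet_subset_verts hF)) C.verts_finite
  omega

variable {V1 : Set (Euc N)} {k : ℕ}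

theorem exists_mixed_isVertexBasis {F : Set (Euc N)} (hV1 : V1 ⊆ C.verts) (hF : F ∈ C.faces)
    (hdim : setDim F + 1 = k) {a b : Euc N} (haF : a ∈ vertSet F) (ha : a ∈ V1)
    (hbF : b ∈ vertSet F) (hb : b ∈ C.verts \ V1) :
    ∃ T ∈ mixedSubsets V1 (C.verts \ V1) k, a ∈ T ∧ b ∈ T ∧ IsVertexBasis F T := by
  have hab : a ≠ b := fun h => hb.2 (h ▸ ha)
  obtain ⟨T, hsT, hT⟩ := exists_isVertexBasis hF
    (insert_subset haF (singleton_subset_iff.2 hbF)) (affineIndependent_pair hab)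
  have haT : a ∈ T := hsT (mem_insert a _)
  have hbT : b ∈ T := hsT (mem_insert_of_mem a rfl)
  refine ⟨T, ⟨?_, ?_, ⟨a, haT, ha⟩, ⟨b, hbT, hb⟩⟩, haT, hbT, hT⟩
  · rw [union_sdiff_cancel hV1]
    exact hT.1.trans (vertSet_subset_verts hF)
  · rw [← setDim_add_one_eq_ncard hT.2.1 ⟨a, haT⟩ hT.2.2, hdim]

/-- If the vertices of a face are affinely independent, each subset of them spans a face. -/
theorem convexHull_mem_faces {F S : Set (Euc N)} (hF : F ∈ C.faces)
    (hind : AffineIndependent ℝ ((↑) : vertSet F → Euc N)) (hS : S ⊆ vertSet F) :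
    convexHull ℝ S ∈ C.faces := by
  refine C.down_closed F hF _ ?_
  nth_rw 1 [← (C.polytope_mem F hF).convexHull_vertSet]
  exact isExposed_convexHull_of_affineIndependent hind hS

/-- The `(k - 1)`-faces of `C` with vertices both in `V1` and outside `V1`. -/
def mixedFaces (C : PolyComplex N) (V1 : Set (Euc N)) (k : ℕ) : Set (Set (Euc N)) :=
  {F ∈ C.faces | ((vertSet F ∩ V1).Nonempty ∧ (vertSet F ∩ (C.verts \ V1)).Nonempty) ∧
    setDim F = k - 1}

/-- An injective choice of vertex bases for the mixed faces. -/
theorem exists_injOn_isVertexBasis (hV1 : V1 ⊆ C.verts) (hk : 1 ≤ k) :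
    ∃ T : Set (Euc N) → Set (Euc N), InjOn T (C.mixedFaces V1 k) ∧
      ∀ F ∈ C.mixedFaces V1 k, T F ∈ mixedSubsets V1 (C.verts \ V1) k ∧ IsVertexBasis F (T F) := by
  have hex : ∀ F ∈ C.mixedFaces V1 k,
      ∃ T, T ∈ mixedSubsets V1 (C.verts \ V1) k ∧ IsVertexBasis F T := by
    rintro F ⟨hF, ⟨⟨a, haF, ha⟩, ⟨b, hbF, hb⟩⟩, hdim⟩
    obtain ⟨T, hT, -, -, hTF⟩ := exists_mixed_isVertexBasis (k := k) hV1 hF (by omega) haF ha hbF hb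
    exact ⟨T, hT, hTF⟩
  choose! T hT using hex
  refine ⟨T, fun F hF G hG hFG => ?_, hT⟩
  exact IsVertexBasis.eq_of_common hF.1 hG.1 (hT F hF).1.2.2.1.left (hT F hF).2
    (hFG ▸ (hT G hG).2)

theorem finite_mixedSubsets_verts (hV1 : V1 ⊆ C.verts) :
    (mixedSubsets V1 (C.verts \ V1) k).Finite :=
  mixedSubsets_finite (C.verts_finite.subset hV1) C.verts_finite.sdiff k

theorem ncard_mixedFaces_le (hV1 : V1 ⊆ C.verts) (hk : 1 ≤ k) :
    (C.mixedFaces V1 k).ncard ≤ (mixedSubsets V1 (C.verts \ V1) k).ncard := by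
  obtain ⟨T, hinj, hT⟩ := exists_injOn_isVertexBasis hV1 hk
  exact ncard_le_ncard_of_injOn T (fun F hF => (hT F hF).1) hinj (finite_mixedSubsets_verts hV1)

/-- If there are as many mixed faces as mixed subsets, then each mixed subset is the vertex set
of a mixed face, and is affinely independent. -/
theorem exists_vertSet_eq_of_ncard_eq (hV1 : V1 ⊆ C.verts) (hk : 1 ≤ k)
    (hcard : (C.mixedFaces V1 k).ncard = (mixedSubsets V1 (C.verts \ V1) k).ncard)
    {U : Set (Euc N)} (hU : U ∈ mixedSubsets V1 (C.verts \ V1) k) :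
    ∃ F ∈ C.faces, vertSet F = U ∧ AffineIndependent ℝ ((↑) : U → Euc N) := by
  obtain ⟨T, hinj, hT⟩ := exists_injOn_isVertexBasis hV1 hk
  have himage : T '' C.mixedFaces V1 k = mixedSubsets V1 (C.verts \ V1) k :=
    eq_of_subset_of_ncard_le (image_subset_iff.2 fun F hF => (hT F hF).1)
      (by rw [hinj.ncard_image, hcard]) (finite_mixedSubsets_verts hV1)
  obtain ⟨F, hF, rfl⟩ := himage.symm ▸ hU
  have hdim : setDim F + 1 = k := by have := hF.2.2; omega
  have huniq : ∀ T' ∈ mixedSubsets V1 (C.verts \ V1) k, IsVertexBasis F T' → T' = T F := by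
    intro T' hT' hb
    obtain ⟨F', hF', rfl⟩ := himage.symm ▸ hT'
    rw [IsVertexBasis.eq_of_common hF.1 hF'.1 hT'.2.2.1.left hb (hT F' hF').2]
  refine ⟨F, hF.1, Subset.antisymm (fun w hw => ?_) (hT F hF).2.1, (hT F hF).2.2.1⟩
  have hwV := vertSet_subset_verts hF.1 hw
  obtain ⟨-, -, ⟨a, haT, ha⟩, ⟨b, hbT, hb⟩⟩ := hU
  by_cases hw1 : w ∈ V1
  · obtain ⟨T', hT', hwT, -, hb'⟩ := exists_mixed_isVertexBasis hV1 hF.1 hdim hw hw1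
      ((hT F hF).2.1 hbT) hb
    exact huniq T' hT' hb' ▸ hwT
  · obtain ⟨T', hT', -, hwT, hb'⟩ := exists_mixed_isVertexBasis hV1 hF.1 hdim
      ((hT F hF).2.1 haT) ha hw ⟨hwV, hw1⟩
    exact huniq T' hT' hb' ▸ hwT

theorem ncard_mixedFaces_eq_iff (hV1 : V1 ⊆ C.verts) (hV1ne : V1.Nonempty)
    (hV2 : (C.verts \ V1).Nonempty) (hk : 1 ≤ k) (hkv : k ≤ C.verts.ncard) :
    (C.mixedFaces V1 k).ncard = (mixedSubsets V1 (C.verts \ V1) k).ncard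
      ↔ C.Bineighborly V1 k := by
  have hfin := C.verts_finite
  constructor
  · refine fun hcard => ⟨hV1ne, hV1.ssubset_of_not_subset fun h => ?_, ?_⟩
    · obtain ⟨b, hb⟩ := hV2
      exact hb.2 (h hb.1)
    · intro S1 S2 hS1 hS2 hS1V hS2V hle
      have hdisj : Disjoint S1 S2 :=
        disjoint_left.2 fun x h1 h2 => (hS2V h2).2 (hS1V h1)
      have hcardU : (S1 ∪ S2).ncard = S1.ncard + S2.ncard :=
        ncard_union_eq hdisj (hfin.subset (hS1V.trans hV1))
          (hfin.subset (hS2V.trans sdiff_subset))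
      obtain ⟨U, hSU, hUV, hUk⟩ := exists_subsuperset_card_eq
        (union_subset (hS1V.trans hV1) (hS2V.trans sdiff_subset)) (hcardU.trans_le hle) hkv
      obtain ⟨a, ha⟩ := hS1
      obtain ⟨b, hb⟩ := hS2
      obtain ⟨F, hF, rfl, hind⟩ := exists_vertSet_eq_of_ncard_eq (U := U) hV1 hk hcard
        ⟨by rwa [union_sdiff_cancel hV1], hUk, ⟨a, hSU (Or.inl ha), hS1V ha⟩,
          ⟨b, hSU (Or.inr hb), hS2V hb⟩⟩
      have hindS := hind.mono hSU
      refine ⟨convexHull ℝ (S1 ∪ S2), convexHull_mem_faces hF hind hSU,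
        vertSet_convexHull_of_affineIndependent hindS, ?_⟩
      rw [← hcardU]
      exact setDim_add_one_eq_ncard hindS ⟨a, Or.inl ha⟩ (affineSpan_convexHull _).symm
  · rintro ⟨-, -, h⟩
    refine (ncard_mixedFaces_le hV1 hk).antisymm ?_
    have hex : ∀ U ∈ mixedSubsets V1 (C.verts \ V1) k,
        ∃ F, F ∈ C.mixedFaces V1 k ∧ vertSet F = U := by
      rintro U ⟨hUV, hUk, hU1, hU2⟩
      have hU : U ∩ V1 ∪ U ∩ (C.verts \ V1) = U := by
        rw [← inter_union_distrib_left, inter_eq_left.2 hUV]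
      have hUfin : U.Finite := hfin.subset (by rwa [union_sdiff_cancel hV1] at hUV)
      have hsum : (U ∩ V1).ncard + (U ∩ (C.verts \ V1)).ncard = k := by
        rw [← ncard_union_eq (disjoint_sdiff_right.mono inter_subset_right inter_subset_right)
          (hUfin.inter_of_left _) (hUfin.inter_of_left _), hU, hUk]
      obtain ⟨F, hF, hFU, hdim⟩ := h _ _ hU1 hU2 inter_subset_right inter_subset_right hsum.le
      rw [hU] at hFU
      exact ⟨F, ⟨hF, ⟨hFU ▸ hU1, hFU ▸ hU2⟩, by omega⟩, hFU⟩
    choose! G hG using hex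
    refine ncard_le_ncard_of_injOn G (fun U hU => (hG U hU).1) (fun U hU W hW hUW => ?_)
      (C.finite_faces.subset fun F hF => hF.1)
    rw [← (hG U hU).2, hUW, (hG W hW).2]

end PolyComplex

/-- the number of `(k-1)`-faces of `C` with at least one vertex in each part of
the partition `{V1, V2}` of the vertex set is at most
`∑_{j=1}^{k-1} binom(n1, j) binom(n2, k-j) = binom(n1+n2, k) - binom(n1, k) - binom(n2, k)`,
with equality iff `C` is `(V1; k)`-bineighborly. -/
theorem statement_8 (N d n1 n2 : ℕ)
    (C : PolyComplex N) (hdc : C.IsDComplex d)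
    (V1 : Set (Euc N)) (hV1 : V1.Nonempty) (hV1sub : V1 ⊆ C.verts)
    (hV2 : (C.verts \ V1).Nonempty)
    (hcard1 : V1.ncard = n1) (hcard2 : (C.verts \ V1).ncard = n2)
    (k : ℕ) (hk1 : 1 ≤ k) (hkd : k ≤ d) :
    ((({F ∈ C.faces |
          ((vertSet F ∩ V1).Nonempty ∧ (vertSet F ∩ (C.verts \ V1)).Nonempty) ∧
            setDim F = k - 1} : Set (Set (Euc N))).ncard : ℤ)
        ≤ ∑ j ∈ Finset.Ico 1 k, (n1.choose j : ℤ) * (n2.choose (k - j) : ℤ)) ∧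
      (∑ j ∈ Finset.Ico 1 k, (n1.choose j : ℤ) * (n2.choose (k - j) : ℤ)
        = ((n1 + n2).choose k : ℤ) - (n1.choose k : ℤ) - (n2.choose k : ℤ)) ∧
      (((({F ∈ C.faces |
            ((vertSet F ∩ V1).Nonempty ∧ (vertSet F ∩ (C.verts \ V1)).Nonempty) ∧
              setDim F = k - 1} : Set (Set (Euc N))).ncard : ℤ)
          = ((n1 + n2).choose k : ℤ) - (n1.choose k : ℤ) - (n2.choose k : ℤ))
        ↔ C.Bineighborly V1 k) := by
  obtain ⟨F, hF, hFd⟩ := hdc.2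
  have hkv : k ≤ C.verts.ncard :=
    (hkd.trans_lt (hFd ▸ PolyComplex.lt_ncard_verts hF (by omega))).le
  have hmixed := ncard_mixedSubsets (C.verts_finite.subset hV1sub) C.verts_finite.sdiff
    disjoint_sdiff_right hk1
  rw [hcard1, hcard2] at hmixed
  have hsum := sum_Ico_choose_mul_choose n1 n2 hk1
  refine ⟨?_, hsum, ?_⟩
  · rw [hsum, ← hmixed]
    exact_mod_cast PolyComplex.ncard_mixedFaces_le hV1sub hk1
  · rw [← hmixed, Nat.cast_inj]
    exact PolyComplex.ncard_mixedFaces_eq_iff hV1sub hV1 hV2 hk1 hkv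
end
end
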